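/- For every integer n ≥ 3 there exists an indecomposable continuum K which is simple-n-od-like, is not simple-(n−1)-od-like, and every proper nondegenerate subcontinuum of K is an arc. -/

import Mathlib

/-! ## Simple-n-ods in the plane, likeness, arcs, triods, indecomposability -/

/-- The simple-`n`-od `T_n ⊆ ℂ`: the union of `n` unit segments emanating from `0`. -/
def simpleOdSet (n : ℕ) : Set ℂ :=
  {z | ∃ t : ℝ, ∃ k : ℕ, t ∈ Set.Icc (0:ℝ) 1 ∧ k < n ∧
    z = (t : ℂ) * Complex.exp (2 * Real.pi * Complex.I * (k : ℂ) / (n : ℂ))}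

/-- `X` is `Y`-like: for every `ε > 0` there is a continuous surjection `X → Y`
all of whose point-inverses have diameter `< ε`. -/
def IsLike (X Y : Type*) [MetricSpace X] [MetricSpace Y] : Prop :=
  ∀ ε : ℝ, 0 < ε → ∃ g : X → Y, Continuous g ∧ Function.Surjective g ∧
    ∀ y : Y, Metric.diam (g ⁻¹' {y}) < ε

/-- `A` is an arc: it is homeomorphic to `[0,1]`. -/
def IsArcSet {K : Type*} [TopologicalSpace K] (A : Set K) : Prop :=
  Nonempty (↥A ≃ₜ ↥(Set.Icc (0:ℝ) 1))

/-- Two sets are mutually separated: neither meets the closure of the other. -/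
def MutuallySeparated {K : Type*} [TopologicalSpace K] (A B : Set K) : Prop :=
  A ∩ closure B = ∅ ∧ closure A ∩ B = ∅

/-- The (sub)continuum `C` is a triod: it contains a subcontinuum `M` such that
`C \ M` is the union of three nonempty pairwise mutually separated sets. -/
def IsTriodSet {K : Type*} [TopologicalSpace K] (C : Set K) : Prop :=
  ∃ M A B D : Set K, IsCompact M ∧ IsConnected M ∧ M ⊆ C ∧
    A.Nonempty ∧ B.Nonempty ∧ D.Nonempty ∧ C \ M = A ∪ B ∪ D ∧
    MutuallySeparated A B ∧ MutuallySeparated A D ∧ MutuallySeparated B D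

/-- A space is atriodic if it contains no subcontinuum which is a triod. -/
def AtriodicSpace (K : Type*) [TopologicalSpace K] : Prop :=
  ∀ C : Set K, IsCompact C → IsConnected C → ¬ IsTriodSet C

/-- A space is indecomposable if it is not the union of two proper subcontinua. -/
def IndecomposableSpace (K : Type*) [TopologicalSpace K] : Prop :=
  ¬ ∃ A B : Set K, IsCompact A ∧ IsConnected A ∧ IsCompact B ∧ IsConnected B ∧
    A ≠ Set.univ ∧ B ≠ Set.univ ∧ A ∪ B = Set.univ

namespace SimpleOd

open Set Filter Topology

/-! ### A coordinate model of the simple `n`-od -/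

/-- The simple `n`-od as the union of the unit segments on the coordinate axes of `ℝⁿ`. -/
def star (n : ℕ) : Set (Fin n → ℝ) :=
  {x | ∃ i, ∃ t ∈ Icc (0 : ℝ) 1, x = Pi.single i t}

section Star

variable {n : ℕ}

theorem single_mem_star (i : Fin n) {t : ℝ} (ht : t ∈ Icc (0 : ℝ) 1) :
    (Pi.single i t : Fin n → ℝ) ∈ star n := ⟨i, t, ht, rfl⟩

theorem continuous_single_real (i : Fin n) :
    Continuous fun t : ℝ => (Pi.single i t : Fin n → ℝ) :=
  continuous_single (A := fun _ : Fin n => ℝ) i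

theorem isCompact_star (n : ℕ) : IsCompact (star n) := by
  have : star n = ⋃ i : Fin n, (fun t : ℝ => (Pi.single i t : Fin n → ℝ)) '' Icc 0 1 := by
    ext x
    simp only [star, mem_ofPred_eq, mem_iUnion, mem_image]
    constructor
    · rintro ⟨i, t, ht, rfl⟩
      exact ⟨i, t, ht, rfl⟩
    · rintro ⟨i, t, ht, rfl⟩
      exact ⟨i, t, ht, rfl⟩
  rw [this]
  exact isCompact_iUnion fun i => isCompact_Icc.image (continuous_single_real i)

theorem eq_single_of_mem_star {x : Fin n → ℝ} (hx : x ∈ star n) {i : Fin n} (hi : x i ≠ 0) :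
    x = Pi.single i (x i) := by
  obtain ⟨j, t, -, rfl⟩ := hx
  rcases eq_or_ne i j with rfl | h
  · simp
  · exact absurd (Pi.single_eq_of_ne (M := fun _ : Fin n => ℝ) h t) hi

theorem nonneg_of_mem_star {x : Fin n → ℝ} (hx : x ∈ star n) (i : Fin n) : 0 ≤ x i := by
  obtain ⟨j, t, ht, rfl⟩ := hx
  rcases eq_or_ne i j with rfl | h
  · simpa using ht.1
  · rw [Pi.single_eq_of_ne h]

theorem le_one_of_mem_star {x : Fin n → ℝ} (hx : x ∈ star n) (i : Fin n) : x i ≤ 1 := by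
  obtain ⟨j, t, ht, rfl⟩ := hx
  rcases eq_or_ne i j with rfl | h
  · simpa using ht.2
  · rw [Pi.single_eq_of_ne h]; exact zero_le_one

theorem eq_zero_of_mem_star {x : Fin n → ℝ} (hx : x ∈ star n) {i j : Fin n} (hij : i ≠ j)
    (hi : x i ≠ 0) : x j = 0 := by
  rw [eq_single_of_mem_star hx hi, Pi.single_eq_of_ne hij.symm]

theorem eq_single_of_le_of_mem_star {x : Fin n → ℝ} (hx : x ∈ star n) {i : Fin n} {t : ℝ}
    (ht : 0 < t) (hi : x i = t) : x = Pi.single i t := by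
  rw [← hi]
  exact eq_single_of_mem_star hx (by rw [hi]; exact ht.ne')

/-- A connected subset of the star contains all intermediate points of a leg. -/
theorem single_mem_of_isPreconnected {C : Set (Fin n → ℝ)} (hC : IsPreconnected C)
    (hCs : C ⊆ star n) {i : Fin n} {x y : Fin n → ℝ} (hx : x ∈ C) (hy : y ∈ C) {t : ℝ}
    (ht : 0 < t) (hxt : x i ≤ t) (hty : t ≤ y i) : (Pi.single i t : Fin n → ℝ) ∈ C := by
  obtain ⟨z, hz, hzt⟩ :=
    hC.intermediate_value hx hy (f := fun z : Fin n → ℝ => z i)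
      (continuous_apply i).continuousOn ⟨hxt, hty⟩
  rwa [← eq_single_of_le_of_mem_star (hCs hz) ht hzt]

/-- A connected subset of the star missing the branch point lies in one leg. -/
theorem exists_leg_of_isPreconnected {C : Set (Fin n → ℝ)} (hC : IsPreconnected C)
    (hCs : C ⊆ star n) (h0 : (0 : Fin n → ℝ) ∉ C) {x : Fin n → ℝ} (hx : x ∈ C) :
    ∃ i, ∀ y ∈ C, 0 < y i ∧ y = Pi.single i (y i) := by
  obtain ⟨i, hi⟩ : ∃ i, x i ≠ 0 := by
    by_contra! h
    exact h0 (by rwa [show (0 : Fin n → ℝ) = x from (funext h).symm])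
  refine ⟨i, fun y hy => ?_⟩
  suffices h : 0 < y i from ⟨h, eq_single_of_mem_star (hCs hy) h.ne'⟩
  by_contra! hyi
  have hyi' : y i = 0 := le_antisymm hyi (nonneg_of_mem_star (hCs hy) i)
  have hopen : IsOpen {z : Fin n → ℝ | 0 < z i} := isOpen_lt continuous_const (continuous_apply i)
  have hopen' : IsOpen {z : Fin n → ℝ | ∃ j, j ≠ i ∧ 0 < z j} := by
    have : {z : Fin n → ℝ | ∃ j, j ≠ i ∧ 0 < z j} = ⋃ j, ⋃ (_ : j ≠ i), {z | 0 < z j} := by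
      ext z; simp
    rw [this]
    exact isOpen_iUnion fun j => isOpen_iUnion fun _ =>
      isOpen_lt continuous_const (continuous_apply j)
  obtain ⟨z, hz, hz1, j, hj, hz2⟩ := hC _ _ hopen hopen' (by
      intro z hz
      obtain ⟨j, hj⟩ : ∃ j, z j ≠ 0 := by
        by_contra! h
        exact h0 (by rwa [show (0 : Fin n → ℝ) = z from (funext h).symm])
      have hj' : 0 < z j := lt_of_le_of_ne (nonneg_of_mem_star (hCs hz) j) hj.symm
      rcases eq_or_ne j i with rfl | hji
      · exact Or.inl hj'
      · exact Or.inr ⟨j, hji, hj'⟩)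
    ⟨x, hx, lt_of_le_of_ne (nonneg_of_mem_star (hCs hx) i) hi.symm⟩
    ⟨y, hy, by
      obtain ⟨j, hj⟩ : ∃ j, y j ≠ 0 := by
        by_contra! h
        exact h0 (by rwa [show (0 : Fin n → ℝ) = y from (funext h).symm])
      exact ⟨j, fun h => hj (h ▸ hyi'), lt_of_le_of_ne (nonneg_of_mem_star (hCs hy) j) hj.symm⟩⟩
  exact hz2.ne' (eq_zero_of_mem_star (hCs hz) hj.symm (ne_of_gt hz1))

theorem isPreconnected_star (n : ℕ) : IsPreconnected (star n) := by
  have : star n = ⋃ i : Fin n, (fun t : ℝ => (Pi.single i t : Fin n → ℝ)) '' Icc 0 1 := by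
    ext x
    simp only [star, mem_ofPred_eq, mem_iUnion, mem_image]
    constructor
    · rintro ⟨i, t, ht, rfl⟩
      exact ⟨i, t, ht, rfl⟩
    · rintro ⟨i, t, ht, rfl⟩
      exact ⟨i, t, ht, rfl⟩
  rw [this, ← sUnion_range]
  refine isPreconnected_sUnion 0 _ ?_ ?_
  · rintro _ ⟨i, rfl⟩
    exact ⟨0, by simp, by simp⟩
  · rintro _ ⟨i, rfl⟩
    exact isPreconnected_Icc.image _ (continuous_single_real i).continuousOn

/-! ### Comparison with the planar simple `n`-od -/

/-- The linear map sending the `k`-th coordinate axis to the ray through `e^{2πik/n}`. -/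
noncomputable def toPlane (n : ℕ) (x : Fin n → ℝ) : ℂ :=
  ∑ i, (x i : ℂ) * Complex.exp (2 * Real.pi * Complex.I * ((i : ℕ) : ℂ) / (n : ℂ))

theorem toPlane_single (i : Fin n) (t : ℝ) :
    toPlane n (Pi.single i t) =
      (t : ℂ) * Complex.exp (2 * Real.pi * Complex.I * ((i : ℕ) : ℂ) / (n : ℂ)) := by
  unfold toPlane
  rw [Finset.sum_eq_single i]
  · simp
  · intro j _ hj
    simp [Pi.single_eq_of_ne hj]
  · simp

theorem norm_toPlane_single (i : Fin n) {t : ℝ} (ht : 0 ≤ t) :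
    ‖toPlane n (Pi.single i t)‖ = t := by
  rw [toPlane_single, norm_mul, Complex.norm_real, Real.norm_of_nonneg ht]
  have : 2 * Real.pi * Complex.I * ((i : ℕ) : ℂ) / (n : ℂ)
      = ((2 * Real.pi * (i : ℕ) / n : ℝ) : ℂ) * Complex.I := by
    push_cast; ring
  rw [this, Complex.norm_exp_ofReal_mul_I, mul_one]

theorem continuous_toPlane : Continuous (toPlane n) := by
  unfold toPlane
  fun_prop

theorem injOn_toPlane : InjOn (toPlane n) (star n) := by
  rintro _ ⟨i, t, ht, rfl⟩ _ ⟨j, s, hs, rfl⟩ h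
  have hts : t = s := by
    rw [← norm_toPlane_single i ht.1, h, norm_toPlane_single j hs.1]
  subst hts
  rcases eq_or_ne t 0 with rfl | ht0
  · simp
  have hn : n ≠ 0 := by
    rintro rfl
    exact i.elim0
  rw [toPlane_single, toPlane_single] at h
  have h' := mul_left_cancel₀ (by exact_mod_cast ht0) h
  have hp := Complex.isPrimitiveRoot_exp n hn
  have key : ∀ k : Fin n, Complex.exp (2 * Real.pi * Complex.I * ((k : ℕ) : ℂ) / (n : ℂ))
      = Complex.exp (2 * Real.pi * Complex.I / n) ^ (k : ℕ) := by
    intro k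
    rw [← Complex.exp_nat_mul]
    congr 1
    ring
  rw [key, key] at h'
  rw [Fin.ext (hp.pow_inj i.2 j.2 h')]

theorem toPlane_image_star : toPlane n '' star n = simpleOdSet n := by
  ext z
  constructor
  · rintro ⟨_, ⟨i, t, ht, rfl⟩, rfl⟩
    exact ⟨t, i, ht, i.2, toPlane_single i t⟩
  · rintro ⟨t, k, ht, hk, rfl⟩
    exact ⟨Pi.single ⟨k, hk⟩ t, single_mem_star _ ht, toPlane_single _ _⟩

/-- The coordinate model is homeomorphic to the planar simple `n`-od. -/
noncomputable def starHomeo (n : ℕ) : star n ≃ₜ simpleOdSet n :=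
  have : CompactSpace (star n) := isCompact_iff_compactSpace.mp (isCompact_star n)
  ((Equiv.Set.imageOfInjOn (toPlane n) (star n) injOn_toPlane).trans
    (Equiv.setCongr toPlane_image_star)).toHomeomorphOfContinuousClosed
    (by
      refine Continuous.subtype_mk (f := fun x : star n => toPlane n x) ?_ _
      exact continuous_toPlane.comp continuous_subtype_val)
    (by
      refine Continuous.isClosedMap ?_
      refine Continuous.subtype_mk (f := fun x : star n => toPlane n x) ?_ _
      exact continuous_toPlane.comp continuous_subtype_val)

end Star

/-! ### Piecewise linear maps of the star given by words -/

/-- The tent function supported on `[-1/2, 1/2]`. -/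
noncomputable def tent (x : ℝ) : ℝ := max 0 (1 - 2 * |x|)

theorem tent_of_le {x : ℝ} (h : 1 / 2 ≤ |x|) : tent x = 0 := max_eq_left (by linarith)

theorem tent_of_ge {x : ℝ} (h : |x| ≤ 1 / 2) : tent x = 1 - 2 * |x| := max_eq_right (by linarith)

/-- The data of a piecewise linear self-map of the star with `n` legs: the leg `i` runs through the
points `letter i k` at height `depth i k`, for `k ≤ len i`, and passes through the branch point
between consecutive ones. -/
structure WordMap (n : ℕ) where
  /-- the leg containing the image of the branch point as its end -/
  base : Fin n
  /-- the number of steps of the image of a leg -/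
  len : Fin n → ℕ
  /-- the legs visited -/
  letter : Fin n → ℕ → Fin n
  /-- the heights reached -/
  depth : Fin n → ℕ → ℝ
  len_pos : ∀ i, 0 < len i
  depth_pos : ∀ i k, 0 < depth i k
  depth_le : ∀ i k, depth i k ≤ 1
  letter_zero : ∀ i, letter i 0 = base
  depth_zero : ∀ i, depth i 0 = 1
  letter_ne : ∀ i k, k < len i → letter i k ≠ letter i (k + 1)

namespace WordMap

variable {n : ℕ} (W : WordMap n)

/-- The image of the leg `i`, parametrized on `[0, 1]`. -/
noncomputable def curve (i : Fin n) (t : ℝ) : Fin n → ℝ :=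
  ∑ k ∈ Finset.range (W.len i + 1),
    Pi.single (W.letter i k) (tent (W.len i * t - k) * W.depth i k)

/-- The self-map determined by the words. -/
noncomputable def map (x : Fin n → ℝ) : Fin n → ℝ :=
  Pi.single W.base 1 + ∑ i, (W.curve i (x i) - Pi.single W.base 1)

theorem continuous_curve (i : Fin n) : Continuous (W.curve i) := by
  unfold curve
  refine continuous_finsetSum _ fun k _ => (continuous_single_real _).comp ?_
  unfold tent
  fun_prop

theorem continuous_map : Continuous W.map := by
  unfold map
  refine continuous_const.add (continuous_finsetSum _ fun i _ => ?_)
  exact ((W.continuous_curve i).comp (continuous_apply i)).sub continuous_const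

theorem curve_near (i : Fin n) {k : ℕ} (hk : k ≤ W.len i) {t u : ℝ} (hu : |u| ≤ 1 / 2)
    (ht : W.len i * t = k + u) :
    W.curve i t = Pi.single (W.letter i k) ((1 - 2 * |u|) * W.depth i k) := by
  unfold curve
  rw [Finset.sum_eq_single k]
  · rw [ht, add_sub_cancel_left, tent_of_ge hu]
  · intro j _ hjk
    rw [tent_of_le, zero_mul, Pi.single_zero]
    rw [ht]
    rw [abs_le] at hu
    rcases lt_or_gt_of_ne hjk with h | h
    · have : (j : ℝ) + 1 ≤ k := by exact_mod_cast h
      exact le_trans (by linarith) (le_abs_self _)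
    · have : (k : ℝ) + 1 ≤ j := by exact_mod_cast h
      exact le_trans (by linarith) (neg_le_abs _)
  · intro h
    exact absurd (Finset.mem_range.2 (Nat.lt_succ_of_le hk)) h

theorem curve_zero (i : Fin n) : W.curve i 0 = Pi.single W.base 1 := by
  rw [W.curve_near i (Nat.zero_le _) (u := 0) (by norm_num) (by simp), W.letter_zero, W.depth_zero]
  simp

theorem map_single (i : Fin n) (t : ℝ) : W.map (Pi.single i t) = W.curve i t := by
  unfold map
  rw [Finset.sum_eq_single i]
  · simp
  · intro j _ hj
    rw [Pi.single_eq_of_ne hj, curve_zero, sub_self]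
  · simp

theorem map_near (i : Fin n) {k : ℕ} (hk : k ≤ W.len i) {t u : ℝ} (hu : |u| ≤ 1 / 2)
    (ht : W.len i * t = k + u) :
    W.map (Pi.single i t) = Pi.single (W.letter i k) ((1 - 2 * |u|) * W.depth i k) := by
  rw [map_single, W.curve_near i hk hu ht]

theorem len_pos' (i : Fin n) : (0 : ℝ) < W.len i := by exact_mod_cast W.len_pos i

/-- The value at a vertex. -/
theorem map_vertex (i : Fin n) {k : ℕ} (hk : k ≤ W.len i) :
    W.map (Pi.single i (k / W.len i)) = Pi.single (W.letter i k) (W.depth i k) := by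
  have := W.len_pos' i
  rw [W.map_near i hk (u := 0) (by norm_num) (by field_simp; ring)]
  simp

/-- The image of a leg passes through the branch point between consecutive vertices. -/
theorem map_mid (i : Fin n) {k : ℕ} (hk : k ≤ W.len i) :
    W.map (Pi.single i ((k + 1 / 2) / W.len i)) = 0 := by
  have := W.len_pos' i
  rw [W.map_near i hk (u := 1 / 2) (by norm_num [abs_of_pos]) (by field_simp)]
  norm_num

theorem map_first (i : Fin n) {k : ℕ} (hk : k ≤ W.len i) {s : ℝ} (hs : 0 ≤ s) (hs' : s ≤ 1 / 2) :
    W.map (Pi.single i ((k + s) / W.len i)) =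
      Pi.single (W.letter i k) ((1 - 2 * s) * W.depth i k) := by
  have := W.len_pos' i
  rw [W.map_near i hk (u := s) (by rwa [abs_of_nonneg hs]) (by field_simp), abs_of_nonneg hs]

theorem map_second (i : Fin n) {k : ℕ} (hk : k < W.len i) {s : ℝ} (hs : 1 / 2 ≤ s) (hs' : s ≤ 1) :
    W.map (Pi.single i ((k + s) / W.len i)) =
      Pi.single (W.letter i (k + 1)) ((2 * s - 1) * W.depth i (k + 1)) := by
  have := W.len_pos' i
  rw [W.map_near i (k := k + 1) hk (u := s - 1) (by rw [abs_le]; constructor <;> linarith)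
    (by push_cast; field_simp; ring), abs_of_nonpos (by linarith)]
  ring_nf

theorem map_mem_star {x : Fin n → ℝ} (hx : x ∈ star n) : W.map x ∈ star n := by
  obtain ⟨i, t, ht, rfl⟩ := hx
  have hL := W.len_pos' i
  have h0 : 0 ≤ W.len i * t := mul_nonneg hL.le ht.1
  obtain ⟨k, hk, hu⟩ : ∃ k : ℕ, k ≤ W.len i ∧ |W.len i * t - k| ≤ 1 / 2 := by
    refine ⟨⌊W.len i * t + 1 / 2⌋₊, ?_, ?_⟩
    · have h2 : W.len i * t + 1 / 2 < (W.len i + 1 : ℕ) := by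
        push_cast
        nlinarith [ht.2]
      have := (Nat.floor_lt (by linarith)).2 h2
      omega
    · have h1 := Nat.floor_le (a := W.len i * t + 1 / 2) (by linarith)
      have h2 := Nat.lt_floor_add_one (W.len i * t + 1 / 2)
      rw [abs_le]
      constructor <;> linarith
  rw [W.map_near i hk hu (by ring)]
  have h1 := abs_nonneg (W.len i * t - k)
  refine single_mem_star _ ⟨mul_nonneg (by linarith) (W.depth_pos i k).le, ?_⟩
  nlinarith [W.depth_pos i k, W.depth_le i k]

theorem iterate_map_mem_star {x : Fin n → ℝ} (hx : x ∈ star n) (k : ℕ) :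
    W.map^[k] x ∈ star n := by
  induction k with
  | zero => exact hx
  | succ k ih => rw [Function.iterate_succ_apply']; exact W.map_mem_star ih

theorem exists_map_eq (i : Fin n) {k : ℕ} (hk : k ≤ W.len i) {r : ℝ}
    (hr : r ∈ Icc 0 (W.depth i k)) :
    ∃ t ∈ Icc (0 : ℝ) 1, W.map (Pi.single i t) = Pi.single (W.letter i k) r := by
  have hL := W.len_pos' i
  have hd := W.depth_pos i k
  set q := r / W.depth i k with hq
  have hq0 : 0 ≤ q := div_nonneg hr.1 hd.le
  have hq1 : q ≤ 1 := (div_le_one hd).2 hr.2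
  have hqr : q * W.depth i k = r := div_mul_cancel₀ _ hd.ne'
  rcases hk.lt_or_eq with h | h
  · have h' : (k : ℝ) + 1 ≤ W.len i := by exact_mod_cast h
    refine ⟨(k + (1 - q) / 2) / W.len i, ⟨div_nonneg ?_ hL.le, (div_le_one hL).2 (by linarith)⟩, ?_⟩
    · have : (0 : ℝ) ≤ k := k.cast_nonneg
      linarith
    · rw [W.map_first i hk (by linarith) (by linarith), ← hqr]
      ring_nf
  · have h' : (1 : ℝ) ≤ W.len i := by exact_mod_cast W.len_pos i
    refine ⟨(k - (1 - q) / 2) / W.len i, ⟨div_nonneg ?_ hL.le, (div_le_one hL).2 ?_⟩, ?_⟩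
    · rw [h]; linarith
    · rw [h]; linarith
    · rw [W.map_near i hk (u := -((1 - q) / 2)) (by rw [abs_neg, abs_le]; constructor <;> linarith)
        (by field_simp; ring), abs_neg, abs_of_nonneg (by linarith), ← hqr]
      ring_nf

/-- The map is injective between consecutive vertices of a leg. -/
theorem injOn_piece (i : Fin n) {k : ℕ} (hk : k < W.len i) :
    InjOn (fun s : ℝ => W.map (Pi.single i ((k + s) / W.len i))) (Icc 0 1) := by
  intro s hs s' hs' h
  have hne := W.letter_ne i k hk
  have hd := W.depth_pos i k
  have hd' := W.depth_pos i (k + 1)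
  simp only at h
  have e1 := congrFun h (W.letter i k)
  have e2 := congrFun h (W.letter i (k + 1))
  rcases le_total s (1 / 2) with h1 | h1 <;> rcases le_total s' (1 / 2) with h2 | h2
  · rw [W.map_first i hk.le hs.1 h1, W.map_first i hk.le hs'.1 h2] at e1
    simp only [Pi.single_eq_same] at e1
    have := mul_right_cancel₀ hd.ne' e1
    linarith
  · rw [W.map_first i hk.le hs.1 h1, W.map_second i hk h2 hs'.2] at e1 e2
    simp only [Pi.single_eq_same, Pi.single_eq_of_ne hne, Pi.single_eq_of_ne hne.symm] at e1 e2
    rcases mul_eq_zero.1 e1 with e1 | e1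
    · rcases mul_eq_zero.1 e2.symm with e2 | e2 <;> linarith
    · linarith
  · rw [W.map_second i hk h1 hs.2, W.map_first i hk.le hs'.1 h2] at e1 e2
    simp only [Pi.single_eq_same, Pi.single_eq_of_ne hne, Pi.single_eq_of_ne hne.symm] at e1 e2
    rcases mul_eq_zero.1 e1.symm with e1 | e1
    · rcases mul_eq_zero.1 e2 with e2 | e2 <;> linarith
    · linarith
  · rw [W.map_second i hk h1 hs.2, W.map_second i hk h2 hs'.2] at e2
    simp only [Pi.single_eq_same] at e2
    have := mul_right_cancel₀ hd'.ne' e2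
    linarith

end WordMap

namespace WordMap

variable {n : ℕ} (W : WordMap n)

/-- A word map is expanding if ends are mapped to ends, vertices are mapped to ends by the second
iterate, and the second iterate of each leg covers the star. -/
structure IsExpanding : Prop where
  map_end : ∀ i, ∃ j, W.map (Pi.single i 1) = Pi.single j 1
  map_map_vertex : ∀ i k, k ≤ W.len i →
    ∃ j, W.map (W.map (Pi.single i (k / W.len i))) = Pi.single j 1
  surj : ∀ i, ∀ y ∈ star n, ∃ t ∈ Icc (0 : ℝ) 1, W.map (W.map (Pi.single i t)) = y

/-- The inverse limit of the star under a word map. -/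
def limit : Set (ℕ → Fin n → ℝ) :=
  {x | ∀ j, x j ∈ star n ∧ W.map (x (j + 1)) = x j}

variable {W}

theorem isCompact_limit : IsCompact W.limit := by
  have h1 : IsCompact (Set.pi univ fun _ : ℕ => star n) :=
    isCompact_univ_pi fun _ => isCompact_star n
  refine h1.of_isClosed_subset ?_ fun x hx j _ => (hx j).1
  have : W.limit = ⋂ j, {x : ℕ → Fin n → ℝ | x j ∈ star n} ∩ {x | W.map (x (j + 1)) = x j} := by
    ext x
    simp [limit]
  rw [this]
  refine isClosed_iInter fun j => IsClosed.inter ?_ ?_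
  · exact (isCompact_star n).isClosed.preimage (continuous_apply j)
  · exact isClosed_eq (W.continuous_map.comp (continuous_apply _)) (continuous_apply _)

instance : CompactSpace W.limit := isCompact_iff_compactSpace.mp isCompact_limit

/-- The projection of the inverse limit to the `j`-th coordinate. -/
def proj (j : ℕ) (x : W.limit) : Fin n → ℝ := x.1 j

theorem continuous_proj (j : ℕ) : Continuous (proj (W := W) j) :=
  (continuous_apply j).comp continuous_subtype_val

theorem proj_mem (j : ℕ) (x : W.limit) : proj j x ∈ star n := (x.2 j).1

theorem map_proj (j : ℕ) (x : W.limit) : W.map (proj (j + 1) x) = proj j x := (x.2 j).2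

theorem iterate_map_proj (k j : ℕ) (x : W.limit) : W.map^[k] (proj (j + k) x) = proj j x := by
  induction k with
  | zero => rfl
  | succ k ih => rw [Function.iterate_succ_apply, ← add_assoc, map_proj, ih]

theorem proj_eq_of_le {i j : ℕ} (hij : i ≤ j) {x y : W.limit} (h : proj j x = proj j y) :
    proj i x = proj i y := by
  obtain ⟨k, rfl⟩ := Nat.exists_eq_add_of_le hij
  rw [← iterate_map_proj k, h, iterate_map_proj]

theorem ext_proj {x y : W.limit} (h : ∀ j, proj j x = proj j y) : x = y :=
  Subtype.ext (funext h)

/-- A closed set of pairs disjoint from the diagonal is separated by some projection. -/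
theorem exists_proj_ne {D : Set (W.limit × W.limit)} (hD : IsClosed D)
    (hne : ∀ p ∈ D, p.1 ≠ p.2) : ∃ N, ∀ p ∈ D, ∀ j, N ≤ j → proj j p.1 ≠ proj j p.2 := by
  obtain ⟨N, hN⟩ := hD.isCompact.elim_directed_cover
    (fun N => {p : W.limit × W.limit | proj N p.1 ≠ proj N p.2})
    (fun N => isOpen_ne_fun ((continuous_proj N).comp continuous_fst)
      ((continuous_proj N).comp continuous_snd))
    (by
      intro p hp
      by_contra h
      simp only [mem_iUnion, not_exists, mem_ofPred_eq, not_not] at h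
      exact hne p hp (ext_proj h))
    (directed_of_isDirected_le fun i j hij p hp h => hp (proj_eq_of_le hij h))
  exact ⟨N, fun p hp j hj h => hN hp (proj_eq_of_le hj h)⟩

theorem image_proj_image {A : Set W.limit} (j : ℕ) :
    W.map '' (proj (j + 1) '' A) = proj j '' A := by
  rw [image_image]
  simp only [map_proj]

/-- A closed proper subset has a proper image under almost all projections. -/
theorem exists_proj_ne_star {A : Set W.limit} (hA : IsClosed A) (hne : A ≠ univ) :
    ∃ N, ∀ j, N ≤ j → ∃ y ∈ star n, y ∉ proj j '' A := by
  obtain ⟨x, hx⟩ := (ne_univ_iff_exists_notMem A).1 hne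
  obtain ⟨N, hN⟩ := exists_proj_ne (isClosed_singleton (x := x) |>.prod hA) (by
    rintro ⟨a, b⟩ ⟨rfl, hb⟩ h
    simp only at h hb hx
    exact hx (h ▸ hb))
  refine ⟨N, fun j hj => ⟨proj j x, proj_mem j x, ?_⟩⟩
  rintro ⟨a, ha, h⟩
  exact hN (x, a) ⟨rfl, ha⟩ j hj h.symm

namespace IsExpanding

variable (hW : W.IsExpanding)
include hW

theorem exists_map_eq {y : Fin n → ℝ} (hy : y ∈ star n) : ∃ x ∈ star n, W.map x = y := by
  obtain ⟨t, ht, h⟩ := hW.surj W.base y hy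
  exact ⟨_, W.map_mem_star (single_mem_star _ ht), h⟩

theorem proj_surjOn (N : ℕ) {y : Fin n → ℝ} (hy : y ∈ star n) :
    ∃ x : W.limit, proj N x = y := by
  choose! s hs hs' using fun y (hy : y ∈ star n) => hW.exists_map_eq hy
  have hmem : ∀ j, s^[j] y ∈ star n := fun j => by
    induction j with
    | zero => exact hy
    | succ j ih => rw [Function.iterate_succ_apply']; exact hs _ ih
  refine ⟨⟨fun j => W.map^[N] (s^[j] y), fun j => ⟨W.iterate_map_mem_star (hmem j) N, ?_⟩⟩, ?_⟩
  · rw [← Function.iterate_succ_apply' W.map, Function.iterate_succ_apply,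
      Function.iterate_succ_apply' s, hs' _ (hmem j)]
  · change W.map^[N] (s^[N] y) = y
    clear hmem
    have : ∀ k, W.map^[k] (s^[k] y) = y ∧ s^[k] y ∈ star n := fun k => by
      induction k with
      | zero => exact ⟨rfl, hy⟩
      | succ k ih =>
        rw [Function.iterate_succ_apply, Function.iterate_succ_apply' s, hs' _ ih.2]
        exact ⟨ih.1, hs _ ih.2⟩
    exact (this N).1

theorem preconnectedSpace : PreconnectedSpace W.limit := by
  refine ⟨isPreconnected_closed_iff.2 ?_⟩
  rintro U V hU hV hUV ⟨u, -, hu⟩ ⟨v, -, hv⟩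
  by_contra hemp
  obtain ⟨N, hN⟩ := exists_proj_ne (hU.prod hV) (by
    rintro ⟨a, b⟩ ⟨ha, hb⟩ h
    simp only at h ha hb
    exact hemp ⟨a, trivial, ha, h ▸ hb⟩)
  obtain ⟨z, -, ⟨a, ha, haz⟩, b, hb, hbz⟩ := isPreconnected_closed_iff.1 (isPreconnected_star n)
    (proj N '' U) (proj N '' V)
    (hU.isCompact.image (continuous_proj N)).isClosed
    (hV.isCompact.image (continuous_proj N)).isClosed
    (by
      intro y hy
      obtain ⟨x, rfl⟩ := hW.proj_surjOn N hy
      exact (hUV (mem_univ x)).imp (mem_image_of_mem _) (mem_image_of_mem _))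
    ⟨_, proj_mem N u, mem_image_of_mem _ hu⟩ ⟨_, proj_mem N v, mem_image_of_mem _ hv⟩
  exact hN (a, b) ⟨ha, hb⟩ N le_rfl (haz.trans hbz.symm)

theorem nonempty : Nonempty W.limit := by
  obtain ⟨x, -⟩ := hW.proj_surjOn 0 (single_mem_star W.base (t := 1) (by simp))
  exact ⟨x⟩

theorem connectedSpace : ConnectedSpace W.limit :=
  { toPreconnectedSpace := hW.preconnectedSpace
    toNonempty := hW.nonempty }

variable {A : Set W.limit}

/-- Almost all projections of a proper subcontinuum omit the branch point or all the ends. -/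
theorem exists_end_notMem (hA : IsClosed A) (hc : IsPreconnected A) (hne : A ≠ univ) :
    ∃ N, ∀ j, N ≤ j → (0 : Fin n → ℝ) ∈ proj j '' A →
      ∀ i, (Pi.single i 1 : Fin n → ℝ) ∉ proj j '' A := by
  obtain ⟨N, hN⟩ := exists_proj_ne_star hA hne
  refine ⟨N + 2, fun j hj h0 i hi => ?_⟩
  obtain ⟨j, rfl⟩ := Nat.exists_eq_add_of_le hj
  obtain ⟨y, hy, hyA⟩ := hN (N + j) (by omega)
  obtain ⟨t, ht, rfl⟩ := hW.surj i y hy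
  have hmem : (Pi.single i t : Fin n → ℝ) ∈ proj (N + 2 + j) '' A := by
    rcases ht.1.eq_or_lt with rfl | h
    · simpa using h0
    · exact single_mem_of_isPreconnected (hc.image _ (continuous_proj _).continuousOn)
        (by rintro _ ⟨a, -, rfl⟩; exact proj_mem _ _) h0 hi h (by simpa using ht.1)
        (by simpa using ht.2)
  apply hyA
  rw [← image_proj_image, ← image_proj_image]
  exact mem_image_of_mem _ (mem_image_of_mem _ (by convert hmem using 3; omega))

theorem indecomposableSpace (hn : 3 ≤ n) : IndecomposableSpace W.limit := by
  rintro ⟨A, B, hA, hAc, hB, hBc, hAne, hBne, hAB⟩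
  obtain ⟨N, hN⟩ := hW.exists_end_notMem hA.isClosed hAc.isPreconnected hAne
  obtain ⟨M, hM⟩ := hW.exists_end_notMem hB.isClosed hBc.isPreconnected hBne
  set j := max N M
  have key : ∀ C : Set W.limit, IsPreconnected C →
      ((0 : Fin n → ℝ) ∈ proj j '' C → ∀ i, (Pi.single i 1 : Fin n → ℝ) ∉ proj j '' C) →
      ∀ a b : Fin n, (Pi.single a 1 : Fin n → ℝ) ∈ proj j '' C →
        (Pi.single b 1 : Fin n → ℝ) ∈ proj j '' C → a = b := by
    intro C hC h a b ha hb
    obtain ⟨i, hi⟩ := exists_leg_of_isPreconnected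
      (hC.image _ (continuous_proj j).continuousOn)
      (by rintro _ ⟨a, -, rfl⟩; exact proj_mem _ _) (fun h0 => h h0 a ha) ha
    have h1 := (hi _ ha).1
    have h2 := (hi _ hb).1
    by_contra hab
    rcases eq_or_ne i a with rfl | hia
    · rw [Pi.single_eq_of_ne hab] at h2
      exact h2.false
    · rw [Pi.single_eq_of_ne hia] at h1
      exact h1.false
  have hcov : ∀ i : Fin n, (Pi.single i 1 : Fin n → ℝ) ∈ proj j '' A ∨
      (Pi.single i 1 : Fin n → ℝ) ∈ proj j '' B := by
    intro i
    obtain ⟨x, hx⟩ := hW.proj_surjOn j (single_mem_star i (t := 1) (by simp))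
    rcases (hAB ▸ mem_univ x : x ∈ A ∪ B) with h | h
    · exact Or.inl ⟨x, h, hx⟩
    · exact Or.inr ⟨x, h, hx⟩
  have kA := key A hAc.isPreconnected (hN j (le_max_left _ _))
  have kB := key B hBc.isPreconnected (hM j (le_max_right _ _))
  have e : ∀ a b : ℕ, ∀ (ha : a < n) (hb : b < n), (⟨a, ha⟩ : Fin n) = ⟨b, hb⟩ → a = b :=
    fun a b ha hb h => congrArg Fin.val h
  rcases hcov ⟨0, by omega⟩ with h0 | h0 <;> rcases hcov ⟨1, by omega⟩ with h1 | h1 <;>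
    rcases hcov ⟨2, by omega⟩ with h2 | h2
  all_goals first
    | exact absurd (e _ _ _ _ (kA _ _ h0 h1)) (by norm_num)
    | exact absurd (e _ _ _ _ (kA _ _ h0 h2)) (by norm_num)
    | exact absurd (e _ _ _ _ (kA _ _ h1 h2)) (by norm_num)
    | exact absurd (e _ _ _ _ (kB _ _ h0 h1)) (by norm_num)
    | exact absurd (e _ _ _ _ (kB _ _ h0 h2)) (by norm_num)
    | exact absurd (e _ _ _ _ (kB _ _ h1 h2)) (by norm_num)

end IsExpanding

end WordMap

namespace WordMap

variable {n : ℕ} {W : WordMap n}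

/-- A connected subset of the star missing all vertices lies in an open piece of a leg, so that the
map is injective on it. -/
theorem injOn_of_isPreconnected {C : Set (Fin n → ℝ)} (hC : IsPreconnected C) (hCs : C ⊆ star n)
    (h : ∀ i k, k < W.len i → (Pi.single i (k / W.len i) : Fin n → ℝ) ∉ C) :
    InjOn W.map C := by
  intro x hx y hy hxy
  have h0 : (0 : Fin n → ℝ) ∉ C := by
    have := h W.base 0 (W.len_pos _)
    simpa using this
  obtain ⟨i, hi⟩ := exists_leg_of_isPreconnected hC hCs h0 hx
  have hL := W.len_pos' i
  set k := ⌈W.len i * x i⌉₊ - 1 with hk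
  have hpos : 0 < W.len i * x i := mul_pos hL (hi x hx).1
  have hceil : 0 < ⌈W.len i * x i⌉₊ := Nat.ceil_pos.2 hpos
  have hk1 : k + 1 = ⌈W.len i * x i⌉₊ := by omega
  have hkx : (k : ℝ) < W.len i * x i := Nat.lt_ceil.1 (by omega)
  have hxk : W.len i * x i ≤ (k : ℝ) + 1 := by
    have := Nat.le_ceil (W.len i * x i)
    rw [← hk1] at this
    exact_mod_cast this
  have hkL : k < W.len i := by
    have h1 := le_one_of_mem_star (hCs hx) i
    have : (k : ℝ) < W.len i := by nlinarith
    exact_mod_cast this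
  have lower : ∀ z ∈ C, (k : ℝ) / W.len i < z i := by
    intro z hz
    by_contra! hlt
    rcases Nat.eq_zero_or_pos k with hk0 | hk0
    · rw [hk0] at hlt
      simp only [Nat.cast_zero, zero_div] at hlt
      exact absurd (hi z hz).1 (not_lt.2 hlt)
    · refine h i k hkL (single_mem_of_isPreconnected hC hCs hz hx
        (div_pos (by exact_mod_cast hk0) hL) hlt ?_)
      rw [div_le_iff₀ hL]
      linarith
  have upper : ∀ z ∈ C, z i ≤ ((k + 1 : ℕ) : ℝ) / W.len i := by
    intro z hz
    by_contra! hlt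
    have hz1 := le_one_of_mem_star (hCs hz) i
    rcases Nat.lt_or_ge (k + 1) (W.len i) with hk0 | hk0
    · refine h i (k + 1) hk0 (single_mem_of_isPreconnected hC hCs hx hz
        (div_pos (by positivity) hL) ?_ hlt.le)
      rw [le_div_iff₀ hL]
      push_cast
      linarith
    · have hk0' : (W.len i : ℝ) ≤ ((k + 1 : ℕ) : ℝ) := by exact_mod_cast hk0
      have := (one_le_div hL).2 hk0'
      linarith
  have repr : ∀ z ∈ C, ∃ s ∈ Icc (0 : ℝ) 1, z = Pi.single i ((k + s) / W.len i) := by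
    intro z hz
    have h1 := lower z hz
    have h2 := upper z hz
    rw [div_lt_iff₀ hL] at h1
    rw [le_div_iff₀ hL] at h2
    push_cast at h2
    refine ⟨z i * W.len i - k, ⟨by linarith, by linarith⟩, ?_⟩
    rw [add_sub_cancel, mul_div_cancel_right₀ _ hL.ne']
    exact (hi z hz).2
  obtain ⟨s, hs, hsx⟩ := repr x hx
  obtain ⟨s', hs', hsy⟩ := repr y hy
  rw [hsx, hsy] at hxy
  rw [hsx, hsy, W.injOn_piece i hkL hs hs' hxy]

namespace IsExpanding

variable (hW : W.IsExpanding)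
include hW

theorem exists_end_mem_of_le {A : Set W.limit} {i j : ℕ} (hij : i ≤ j)
    (h : ∃ a, (Pi.single a 1 : Fin n → ℝ) ∈ proj j '' A) :
    ∃ a, (Pi.single a 1 : Fin n → ℝ) ∈ proj i '' A := by
  induction j, hij using Nat.le_induction with
  | base => exact h
  | succ j _ ih =>
    obtain ⟨a, ha⟩ := h
    obtain ⟨b, hb⟩ := hW.map_end a
    exact ih ⟨b, by rw [← hb, ← image_proj_image]; exact mem_image_of_mem _ ha⟩

/-- Almost all projections of a proper subcontinuum miss the vertices. -/
theorem exists_vertex_notMem {A : Set W.limit} (hA : IsClosed A) (hc : IsPreconnected A)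
    (hne : A ≠ univ) :
    ∃ N, ∀ j, N ≤ j → ∀ i k, k < W.len i →
      (Pi.single i (k / W.len i) : Fin n → ℝ) ∉ proj j '' A := by
  obtain ⟨N, hN⟩ := hW.exists_end_notMem hA hc hne
  by_contra! hcon
  have hpc : ∀ j, IsPreconnected (proj j '' A) := fun j =>
    hc.image _ (continuous_proj j).continuousOn
  have hsub : ∀ j, proj j '' A ⊆ star n := by
    rintro j _ ⟨a, -, rfl⟩
    exact proj_mem j a
  have hends : ∀ j, ∃ a, (Pi.single a 1 : Fin n → ℝ) ∈ proj j '' A := by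
    intro j
    obtain ⟨j', hj', i, k, hk, hmem⟩ := hcon (j + 2)
    obtain ⟨l, rfl⟩ := Nat.exists_eq_add_of_le hj'
    refine hW.exists_end_mem_of_le (j := j + l) (by omega) ?_
    obtain ⟨b, hb⟩ := hW.map_map_vertex i k hk.le
    refine ⟨b, ?_⟩
    rw [← hb, ← image_proj_image, ← image_proj_image]
    exact mem_image_of_mem _ (mem_image_of_mem _ (by convert hmem using 3; omega))
  have hzero : ∀ j, N ≤ j → (0 : Fin n → ℝ) ∉ proj j '' A := by
    intro j hj h0
    obtain ⟨a, ha⟩ := hends j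
    exact hN j hj h0 a ha
  obtain ⟨j', hj', i, k, hk, hmem⟩ := hcon (N + 1)
  obtain ⟨l, rfl⟩ := Nat.exists_eq_add_of_le hj'
  obtain ⟨a, ha⟩ := hends (N + 1 + l)
  have hL := W.len_pos' i
  have hk' : (k : ℝ) + 1 ≤ W.len i := by exact_mod_cast hk
  have hk0 : 0 < (k : ℝ) / W.len i := by
    refine lt_of_le_of_ne (by positivity) fun h => ?_
    rw [← h] at hmem
    exact hzero (N + 1 + l) (by omega) (by simpa using hmem)
  obtain ⟨i', hi'⟩ := exists_leg_of_isPreconnected (hpc _) (hsub _) (hzero _ (by omega)) ha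
  have hii : i' = i := by
    by_contra h
    have := (hi' _ hmem).1
    rw [Pi.single_eq_of_ne h] at this
    exact this.false
  have hia : i' = a := by
    by_contra h
    have := (hi' _ ha).1
    rw [Pi.single_eq_of_ne h] at this
    exact this.false
  subst hii hia
  refine hzero (N + l) (by omega) ?_
  rw [← W.map_mid i' hk.le, ← image_proj_image]
  refine mem_image_of_mem _ ?_
  convert single_mem_of_isPreconnected (hpc _) (hsub _) hmem ha
    (t := ((k : ℝ) + 1 / 2) / W.len i') (by positivity) ?_ ?_ using 3
  · omega
  · simp only [Pi.single_eq_same]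
    gcongr
    linarith
  · simp only [Pi.single_eq_same]
    rw [div_le_one hL]
    linarith

/-- Every proper nondegenerate subcontinuum of the inverse limit is an arc. -/
theorem isArcSet {A : Set W.limit} (hA : IsCompact A) (hc : IsConnected A)
    (hne : A ≠ univ) (hA2 : A.Nontrivial) : IsArcSet A := by
  obtain ⟨N, hN⟩ := hW.exists_vertex_notMem hA.isClosed hc.isPreconnected hne
  have hpc : ∀ j, IsPreconnected (proj j '' A) := fun j =>
    hc.isPreconnected.image _ (continuous_proj j).continuousOn
  have hsub : ∀ j, proj j '' A ⊆ star n := by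
    rintro j _ ⟨a, -, rfl⟩
    exact proj_mem j a
  have hinj : InjOn (proj N) A := by
    intro x hx y hy hxy
    have hle : ∀ j, N ≤ j → proj j x = proj j y := by
      intro j hj
      induction j, hj using Nat.le_induction with
      | base => exact hxy
      | succ j hj ih =>
        refine injOn_of_isPreconnected (hpc (j + 1)) (hsub _) (hN _ (by omega))
          (mem_image_of_mem _ hx) (mem_image_of_mem _ hy) ?_
        rw [map_proj, map_proj, ih]
    refine ext_proj fun j => ?_
    rcases le_total N j with h | h
    · exact hle j h
    · exact proj_eq_of_le h hxy
  obtain ⟨x, hx⟩ := hc.nonempty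
  obtain ⟨i, hi⟩ := exists_leg_of_isPreconnected (hpc N) (hsub N)
    (by simpa using hN N le_rfl W.base 0 (W.len_pos _)) (mem_image_of_mem _ hx)
  set f : W.limit → ℝ := fun x => proj N x i with hf
  have hfc : Continuous f := (continuous_apply i).comp (continuous_proj N)
  have hfinj : InjOn f A := by
    intro x hx y hy hxy
    apply hinj hx hy
    rw [(hi _ (mem_image_of_mem _ hx)).2, (hi _ (mem_image_of_mem _ hy)).2]
    simp only [hf] at hxy
    rw [hxy]
  obtain ⟨a, b, hab⟩ : ∃ a b, f '' A = Icc a b :=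
    ⟨_, _, eq_Icc_of_connected_compact (hc.image f hfc.continuousOn) (hA.image hfc)⟩
  have hlt : a < b := by
    obtain ⟨x, hx, y, hy, hxy⟩ := hA2
    have h1 : f x ∈ Icc a b := hab ▸ mem_image_of_mem f hx
    have h2 : f y ∈ Icc a b := hab ▸ mem_image_of_mem f hy
    by_contra! h
    exact hxy (hfinj hx hy (by linarith [h1.1, h1.2, h2.1, h2.2]))
  have : CompactSpace A := isCompact_iff_compactSpace.mp hA
  refine ⟨Homeomorph.trans (((Equiv.Set.imageOfInjOn f A hfinj).trans
    (Equiv.setCongr hab)).toHomeomorphOfContinuousClosed ?_ ?_) (iccHomeoI a b hlt)⟩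
  · exact Continuous.subtype_mk (f := fun x : A => f x) (hfc.comp continuous_subtype_val) _
  · refine Continuous.isClosedMap ?_
    exact Continuous.subtype_mk (f := fun x : A => f x) (hfc.comp continuous_subtype_val) _

end IsExpanding

end WordMap

theorem exists_pos_forall_le {X : Type*} [TopologicalSpace X] {D : Set X} (hD : IsCompact D)
    {f : X → ℝ} (hf : Continuous f) (hpos : ∀ x ∈ D, 0 < f x) : ∃ δ > 0, ∀ x ∈ D, δ ≤ f x := by
  rcases D.eq_empty_or_nonempty with rfl | hne
  · exact ⟨1, one_pos, by simp⟩
  · obtain ⟨x, hx, h⟩ := hD.exists_isMinOn hne hf.continuousOn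
    exact ⟨f x, hpos x hx, fun y hy => h hy⟩

namespace WordMap

variable {n : ℕ} {W : WordMap n}

/-- A metric on the inverse limit compatible with its topology. -/
noncomputable abbrev limitMetric (W : WordMap n) : MetricSpace W.limit :=
  TopologicalSpace.metrizableSpaceMetric W.limit

theorem IsExpanding.isLike (hW : W.IsExpanding) :
    letI := W.limitMetric
    IsLike W.limit (simpleOdSet n) := by
  let _ := W.limitMetric
  intro ε hε
  obtain ⟨N, hN⟩ := exists_proj_ne
    (isClosed_le (continuous_const (y := ε / 2)) (continuous_dist (α := W.limit)))
    (by
      rintro ⟨a, b⟩ h (heq : a = b)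
      simp only [mem_ofPred_eq, heq, dist_self] at h
      linarith)
  refine ⟨fun x => starHomeo n ⟨proj N x, proj_mem N x⟩, ?_, ?_, ?_⟩
  · exact (starHomeo n).continuous.comp ((continuous_proj N).subtype_mk _)
  · intro y
    obtain ⟨x, hx⟩ := hW.proj_surjOn N ((starHomeo n).symm y).2
    refine ⟨x, ?_⟩
    rw [← (starHomeo n).apply_symm_apply y]
    exact congrArg _ (Subtype.ext hx)
  · intro y
    refine lt_of_le_of_lt (Metric.diam_le_of_forall_dist_le (half_pos hε).le ?_) (half_lt_self hε)
    intro a ha b hb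
    by_contra! h
    have hab := (starHomeo n).injective ((show _ = y from ha).trans (show _ = y from hb).symm)
    exact hN (a, b) h.le N le_rfl (congrArg Subtype.val hab)

/-- If the inverse limit is `T_m`-like, then maps with small fibres to the star with `m` legs
induce almost continuous maps between stars which almost identify no points that are separated by
an iterate of the word map. -/
theorem IsExpanding.exists_approx (hW : W.IsExpanding) {m : ℕ}
    (hlike : letI := W.limitMetric; IsLike W.limit (simpleOdSet m)) {ε : ℝ} (hε : 0 < ε) :
    ∃ (N : ℕ) (η ζ : ℝ) (h : (Fin n → ℝ) → (Fin m → ℝ)), 0 < η ∧ 0 < ζ ∧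
      (∀ z ∈ star n, h z ∈ star m) ∧
      (∀ z ∈ star n, ∀ w ∈ star n, dist z w < ζ → dist (h z) (h w) < η / 2) ∧
      ∀ z ∈ star n, ∀ w ∈ star n, dist (h z) (h w) < η → dist (W.map^[N] z) (W.map^[N] w) < ε := by
  let _ := W.limitMetric
  have hD : IsCompact {p : W.limit × W.limit | ε ≤ dist (proj 0 p.1) (proj 0 p.2)} :=
    (isClosed_le continuous_const (((continuous_proj 0).comp continuous_fst).dist
      ((continuous_proj 0).comp continuous_snd))).isCompact
  obtain ⟨δ, hδ, hδD⟩ := exists_pos_forall_le hD (continuous_dist (α := W.limit)) (by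
    rintro ⟨a, b⟩ h
    simp only [mem_ofPred_eq] at h
    refine dist_pos.2 fun (heq : a = b) => ?_
    rw [heq, dist_self] at h
    linarith)
  obtain ⟨g', hg', -, hfib⟩ := hlike δ hδ
  set g : W.limit → (Fin m → ℝ) := fun x => ((starHomeo m).symm (g' x)).1 with hg
  have hgc : Continuous g := continuous_subtype_val.comp ((starHomeo m).symm.continuous.comp hg')
  have hgd : ∀ x y, g x = g y → dist x y < δ := by
    intro x y hxy
    have h1 : g' x = g' y := (starHomeo m).symm.injective (Subtype.ext hxy)
    refine lt_of_le_of_lt (Metric.dist_le_diam_of_mem ?_ (by exact h1 : x ∈ g' ⁻¹' {g' y}) rfl)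
      (hfib (g' y))
    exact (isClosed_singleton.preimage hg').isCompact.isBounded
  have hgdist : Continuous fun p : W.limit × W.limit => dist (g p.1) (g p.2) :=
    (hgc.comp continuous_fst).dist (hgc.comp continuous_snd)
  obtain ⟨η, hη, hηD⟩ := exists_pos_forall_le hD hgdist (by
    rintro ⟨a, b⟩ h
    refine dist_pos.2 fun heq => ?_
    exact absurd (hδD _ h) (not_le.2 (hgd _ _ heq)))
  have hE : IsClosed {p : W.limit × W.limit | η / 2 ≤ dist (g p.1) (g p.2)} :=
    isClosed_le continuous_const hgdist
  obtain ⟨N, hN⟩ := exists_proj_ne hE (by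
    rintro ⟨a, b⟩ h (heq : a = b)
    simp only [mem_ofPred_eq, heq, dist_self] at h
    linarith)
  obtain ⟨ζ, hζ, hζE⟩ := exists_pos_forall_le hE.isCompact
    (((continuous_proj N).comp continuous_fst).dist ((continuous_proj N).comp continuous_snd))
    (fun p hp => dist_pos.2 (hN p hp N le_rfl))
  have := hW.nonempty
  choose! s hs using fun y (hy : y ∈ star n) => hW.proj_surjOn N hy
  refine ⟨N, η, ζ, fun z => g (s z), hη, hζ, fun z _ => ((starHomeo m).symm _).2, ?_, ?_⟩
  · intro z hz w hw hzw
    by_contra! h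
    have := hζE (s z, s w) h
    simp only [Function.comp_apply, hs z hz, hs w hw] at this
    linarith
  · intro z hz w hw hzw
    by_contra! h
    refine absurd (hηD (s z, s w) ?_) (not_le.2 hzw)
    have e : ∀ x : W.limit, proj 0 x = W.map^[N] (proj N x) := fun x => by
      have := iterate_map_proj N 0 x
      rw [zero_add] at this
      exact this.symm
    simpa only [mem_ofPred_eq, e, hs z hz, hs w hw] using h

theorem IsExpanding.exists_continuum (hW : W.IsExpanding) (hn : 3 ≤ n)
    (hlike : letI := W.limitMetric; ¬ IsLike W.limit (simpleOdSet (n - 1))) :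
    ∃ (K : Type) (_ : MetricSpace K), CompactSpace K ∧ ConnectedSpace K ∧ Nonempty K ∧
      IndecomposableSpace K ∧ IsLike K (simpleOdSet n) ∧ ¬ IsLike K (simpleOdSet (n - 1)) ∧
      ∀ A : Set K, IsCompact A → IsConnected A → A ≠ Set.univ → A.Nontrivial → IsArcSet A :=
  ⟨W.limit, W.limitMetric, inferInstance, hW.connectedSpace, hW.nonempty,
    hW.indecomposableSpace hn, hW.isLike, hlike, fun _ h1 h2 h3 h4 => hW.isArcSet h1 h2 h3 h4⟩

end WordMap

/-! ### Betweenness in the star -/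

section Between

variable {m : ℕ}

/-- The order interval between two points of `ℝᵐ`; it contains the points of the star on the arc
between two points of the star. -/
def between (a b : Fin m → ℝ) : Set (Fin m → ℝ) := {y | ∀ i, y i ∈ uIcc (a i) (b i)}

theorem left_mem_between (a b : Fin m → ℝ) : a ∈ between a b := fun _ => left_mem_uIcc

theorem right_mem_between (a b : Fin m → ℝ) : b ∈ between a b := fun _ => right_mem_uIcc

theorem between_comm (a b : Fin m → ℝ) : between a b = between b a := by
  simp only [between, uIcc_comm]

theorem between_subset_left {a b s : Fin m → ℝ} (hs : s ∈ between a b) :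
    between a s ⊆ between a b :=
  fun _ hy i => uIcc_subset_uIcc_left (hs i) (hy i)

theorem dist_le_of_mem_between {a b y : Fin m → ℝ} (hy : y ∈ between a b) :
    dist y a ≤ dist a b := by
  refine (dist_pi_le_iff dist_nonneg).2 fun i => ?_
  rw [dist_comm]
  exact (Real.dist_left_le_of_mem_uIcc (hy i)).trans (dist_le_pi_dist a b i)

theorem between_subset_union {a b c y : Fin m → ℝ} (ha : a ∈ star m) (hb : b ∈ star m)
    (hc : c ∈ star m) (hys : y ∈ star m) (hy : y ∈ between a c) :
    y ∈ between a b ∨ y ∈ between b c := by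
  by_contra! hcon
  simp only [between, mem_ofPred_eq, not_forall] at hcon
  obtain ⟨⟨i, hi⟩, j, hj⟩ := hcon
  have h1 : ∀ k, y k ∈ uIcc (a k) (b k) ∨ y k ∈ uIcc (b k) (c k) := fun k =>
    uIcc_subset_uIcc_union_uIcc (hy k)
  have hij : i ≠ j := by
    rintro rfl
    exact (h1 i).elim hi hj
  have hi' := (h1 i).resolve_left hi
  have hj' := (h1 j).resolve_right hj
  have key : ∀ {x : Fin m → ℝ}, x ∈ star m → x i = 0 ∨ x j = 0 := fun {x} hx => by
    by_contra! h
    exact h.2 (eq_zero_of_mem_star hx hij h.1)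
  have pos : ∀ {x : Fin m → ℝ}, x ∈ star m → 0 ≤ x i ∧ 0 ≤ x j := fun hx =>
    ⟨nonneg_of_mem_star hx i, nonneg_of_mem_star hx j⟩
  have yi := hy i
  have yj := hy j
  have pa := pos ha
  have pb := pos hb
  have pc := pos hc
  have py := pos hys
  simp only [mem_uIcc, not_or, not_and_or, not_le] at *
  rcases key ha with a0 | a0 <;> rcases key hb with b0 | b0 <;> rcases key hc with c0 | c0 <;>
    rcases key hys with y0 | y0 <;> grind

/-- A point between the first and the last term of a sequence in the star is between two
consecutive terms. -/
theorem exists_mem_between_succ {f : ℕ → Fin m → ℝ} (hf : ∀ k, f k ∈ star m) {y : Fin m → ℝ}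
    (hys : y ∈ star m) (M : ℕ) (hy : y ∈ between (f 0) (f (M + 1))) :
    ∃ k ≤ M, y ∈ between (f k) (f (k + 1)) := by
  induction M with
  | zero => exact ⟨0, le_rfl, hy⟩
  | succ M ih =>
    rcases between_subset_union (hf 0) (hf (M + 1)) (hf (M + 2)) hys hy with h | h
    · obtain ⟨k, hk, h⟩ := ih h
      exact ⟨k, hk.trans (Nat.le_succ M), h⟩
    · exact ⟨M + 1, le_rfl, h⟩

theorem mem_between_single_same {i : Fin m} {s t u : ℝ} (hu : u ∈ uIcc s t) :
    (Pi.single i u : Fin m → ℝ) ∈ between (Pi.single i s) (Pi.single i t) := by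
  intro k
  rcases eq_or_ne k i with rfl | h
  · simpa using hu
  · simp [Pi.single_eq_of_ne h]

theorem mem_between_single_left {i j : Fin m} (hij : i ≠ j) {s t u : ℝ} (hu : 0 ≤ u)
    (hus : u ≤ s) (ht : 0 ≤ t) :
    (Pi.single i u : Fin m → ℝ) ∈ between (Pi.single i s) (Pi.single j t) := by
  intro k
  rcases eq_or_ne k i with rfl | h
  · simp [Pi.single_eq_of_ne hij, mem_uIcc, hu, hus]
  · rcases eq_or_ne k j with rfl | h'
    · simp [Pi.single_eq_of_ne h, ht]
    · simp [Pi.single_eq_of_ne h, Pi.single_eq_of_ne h']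

end Between

/-! ### Potentials of labelled finite sets in the star -/

theorem add_eq_of_antisymm {κ : Type*} {g : κ → κ → ℝ} (hg : ∀ a c, g a c = -g c a) {a c : κ}
    {x y z : κ} (hx : x = a ∨ x = c) (hy : y = a ∨ y = c) (hz : z = a ∨ z = c) :
    g x y + g y z = g x z := by
  have h0 : ∀ x, g x x = 0 := fun x => by linarith [hg x x]
  have := hg a c
  rcases hx with rfl | rfl <;> rcases hy with rfl | rfl <;> rcases hz with rfl | rfl <;>
    simp only [h0] <;> linarith

/-- For labelled points on the line, there is a potential with prescribed differences between any
two points spanning an interval in which only two labels occur. -/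
theorem exists_potential_line {ι κ : Type*} {g : κ → κ → ℝ} (hg : ∀ a c, g a c = -g c a)
    (f : ι → ℝ) (lab : ι → κ) (P : Finset ι) :
    ∃ U : ι → ℝ, ∀ p ∈ P, ∀ r ∈ P, ∀ a c,
      (∀ q ∈ P, f q ∈ uIcc (f p) (f r) → lab q = a ∨ lab q = c) →
      U r - U p = g (lab p) (lab r) := by
  classical
  have h0 : ∀ x, g x x = 0 := fun x => by linarith [hg x x]
  induction P using Finset.induction_on_max_value f with
  | empty => exact ⟨0, by simp⟩
  | insert p s hps hmax ih =>
    obtain ⟨U, hU⟩ := ih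
    rcases s.eq_empty_or_nonempty with rfl | hne
    · refine ⟨0, fun q hq r hr a c _ => ?_⟩
      simp only [insert_empty_eq, Finset.mem_singleton] at hq hr
      rw [hq, hr, h0]
      simp
    · obtain ⟨q, hq, hqmax⟩ := s.exists_max_image f hne
      have hUs : ∀ x ∈ s, Function.update U p (U q + g (lab q) (lab p)) x = U x := fun x hx =>
        Function.update_of_ne (fun h => hps (by rwa [h] at hx)) _ _
      have hUp : Function.update U p (U q + g (lab q) (lab p)) p = U q + g (lab q) (lab p) :=
        Function.update_self _ _ _
      have key : ∀ r ∈ s, ∀ a c,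
          (∀ q ∈ insert p s, f q ∈ uIcc (f r) (f p) → lab q = a ∨ lab q = c) →
          U q + g (lab q) (lab p) - U r = g (lab r) (lab p) := by
        intro r hr a c hac
        have hrq := hqmax r hr
        have hqp := hmax q hq
        have h1 := hU r hr q hq a c (fun x hx hxm => hac x (Finset.mem_insert_of_mem hx)
          (by rw [uIcc_of_le hrq] at hxm; rw [uIcc_of_le (hrq.trans hqp)]
              exact ⟨hxm.1, hxm.2.trans hqp⟩))
        have h2 := add_eq_of_antisymm hg (hac r (Finset.mem_insert_of_mem hr) left_mem_uIcc)
          (hac q (Finset.mem_insert_of_mem hq)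
            (by rw [uIcc_of_le (hrq.trans hqp)]; exact ⟨hrq, hqp⟩))
          (hac p (Finset.mem_insert_self _ _) right_mem_uIcc)
        linarith
      refine ⟨Function.update U p (U q + g (lab q) (lab p)), fun x hx r hr a c hac => ?_⟩
      rcases Finset.mem_insert.1 hx with rfl | hx' <;> rcases Finset.mem_insert.1 hr with rfl | hr'
      · rw [sub_self, h0]
      · rw [hUs r hr', hUp, hg (lab x) (lab r), ← key r hr' a c (by rwa [uIcc_comm])]
        ring
      · rw [hUs x hx', hUp, key x hx' a c hac]
      · rw [hUs x hx', hUs r hr']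
        exact hU x hx' r hr' a c fun q hq => hac q (Finset.mem_insert_of_mem hq)

/-- The contribution of a step from the label `a` to the label `c` to the potential associated with
the label `l` and the weights `φ`. -/
def jump {n : ℕ} (l : Fin n) (φ : Fin n → ℝ) (a c : Fin n) : ℝ :=
  (if c = l then φ a else 0) - if a = l then φ c else 0

theorem jump_antisymm {n : ℕ} (l : Fin n) (φ : Fin n → ℝ) (a c : Fin n) :
    jump l φ a c = -jump l φ c a := by
  unfold jump
  ring

/-- For finitely many labelled points of the star with fewer legs than there are labels, there is
a label `l` such that for all weights there is a potential with prescribed differences between any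
two points spanning an arc in which only two labels occur. -/
theorem exists_potential {ι : Type*} {m n : ℕ} (hmn : m < n) (P : Finset ι)
    (h : ι → Fin m → ℝ) (hh : ∀ p ∈ P, h p ∈ star m) (lab : ι → Fin n) :
    ∃ l : Fin n, ∀ φ : Fin n → ℝ, ∃ U : ι → ℝ, ∀ p ∈ P, ∀ r ∈ P, ∀ a c,
      (∀ q ∈ P, h q ∈ between (h p) (h r) → lab q = a ∨ lab q = c) →
      U r - U p = jump l φ (lab p) (lab r) := by
  classical
  rcases P.eq_empty_or_nonempty with rfl | ⟨p₀, hp₀⟩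
  · exact ⟨⟨0, by omega⟩, fun φ => ⟨0, by simp⟩⟩
  have : Nonempty (Fin m) := ⟨(hh p₀ hp₀).choose⟩
  choose! leg rad hrad hleg using fun p hp => hh p hp
  set Q : Fin m → Finset ι := fun i => P.filter fun p => leg p = i with hQ
  have hroot : ∀ i, ∃ p, (Q i).Nonempty → p ∈ Q i ∧ ∀ q ∈ Q i, rad p ≤ rad q := by
    intro i
    by_cases hne : (Q i).Nonempty
    · obtain ⟨p, hp, hmin⟩ := (Q i).exists_min_image rad hne
      exact ⟨p, fun _ => ⟨hp, hmin⟩⟩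
    · exact ⟨p₀, fun h => absurd h hne⟩
  choose root hroot using hroot
  obtain ⟨l, hl⟩ : ∃ l, ∀ i, lab (root i) ≠ l := by
    by_contra! hcon
    have := Fintype.card_le_of_surjective (fun i => lab (root i)) hcon
    simp only [Fintype.card_fin] at this
    omega
  refine ⟨l, fun φ => ?_⟩
  choose V hV using fun i => exists_potential_line (jump_antisymm l φ) rad lab (Q i)
  have hmem : ∀ {p i}, p ∈ Q i ↔ p ∈ P ∧ leg p = i := Finset.mem_filter
  refine ⟨fun p => V (leg p) p - V (leg p) (root (leg p)), fun p hp r hr a c hac => ?_⟩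
  have hpQ : p ∈ Q (leg p) := hmem.2 ⟨hp, rfl⟩
  have hrQ : r ∈ Q (leg r) := hmem.2 ⟨hr, rfl⟩
  by_cases hpr : leg p = leg r
  · have := hV (leg r) p (hpr ▸ hpQ) r hrQ a c fun q hq hqm => by
      obtain ⟨hqP, hql⟩ := hmem.1 hq
      refine hac q hqP ?_
      rw [hleg q hqP, hleg p hp, hleg r hr, hql, hpr]
      exact mem_between_single_same hqm
    simp only [hpr]
    linarith
  · have aux : ∀ p ∈ P, ∀ r ∈ P, leg p ≠ leg r →
        (∀ q ∈ P, h q ∈ between (h p) (h r) → lab q = a ∨ lab q = c) →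
        V (leg p) p - V (leg p) (root (leg p)) = jump l φ (lab (root (leg p))) (lab p) ∧
          (lab (root (leg p)) = a ∨ lab (root (leg p)) = c) := by
      intro p hp r hr hpr hac
      have hpQ : p ∈ Q (leg p) := hmem.2 ⟨hp, rfl⟩
      obtain ⟨hr1, hr2⟩ := hroot (leg p) ⟨p, hpQ⟩
      have hcl : ∀ q ∈ Q (leg p), rad q ≤ rad p → lab q = a ∨ lab q = c := by
        intro q hq hqr
        obtain ⟨hqP, hql⟩ := hmem.1 hq
        refine hac q hqP ?_
        rw [hleg q hqP, hleg p hp, hleg r hr, hql]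
        exact mem_between_single_left hpr (hrad q hqP).1 hqr (hrad r hr).1
      refine ⟨hV (leg p) _ hr1 p hpQ a c fun q hq hqm => hcl q hq ?_, hcl _ hr1 (hr2 p hpQ)⟩
      rw [uIcc_of_le (hr2 p hpQ)] at hqm
      exact hqm.2
    obtain ⟨e1, l1⟩ := aux p hp r hr hpr hac
    obtain ⟨e2, l2⟩ := aux r hr p hp (Ne.symm hpr) (by simpa only [between_comm] using hac)
    simp only [e1, e2]
    have lp := hac p hp (left_mem_between _ _)
    have lr := hac r hr (right_mem_between _ _)
    have n1 := hl (leg p)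
    have n2 := hl (leg r)
    unfold jump
    grind

/-- The path in the star from the end of leg `a` to the end of leg `c`. -/
noncomputable def endPath {n : ℕ} (a c : Fin n) (t : ℝ) : Fin n → ℝ :=
  Pi.single a (max 0 (1 - 2 * t)) + Pi.single c (max 0 (2 * t - 1))

section EndPath

variable {n : ℕ}

theorem endPath_first (a c : Fin n) {t : ℝ} (ht : t ≤ 1 / 2) :
    endPath a c t = Pi.single a (1 - 2 * t) := by
  rw [endPath, max_eq_right (by linarith), max_eq_left (by linarith), Pi.single_zero, add_zero]

theorem endPath_second (a c : Fin n) {t : ℝ} (ht : 1 / 2 ≤ t) :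
    endPath a c t = Pi.single c (2 * t - 1) := by
  rw [endPath, max_eq_left (by linarith), max_eq_right (by linarith), Pi.single_zero, zero_add]

theorem endPath_symm (a c : Fin n) (t : ℝ) : endPath a c (1 - t) = endPath c a t := by
  unfold endPath
  rw [add_comm]
  ring_nf

theorem continuous_endPath (a c : Fin n) : Continuous (endPath a c) := by
  unfold endPath
  exact ((continuous_single_real a).comp (by fun_prop)).add
    ((continuous_single_real c).comp (by fun_prop))

theorem endPath_mem_star (a c : Fin n) {t : ℝ} (ht : t ∈ Icc (0 : ℝ) 1) :
    endPath a c t ∈ star n := by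
  rcases le_total t (1 / 2) with h | h
  · rw [endPath_first a c h]
    exact single_mem_star _ ⟨by linarith, by linarith [ht.1]⟩
  · rw [endPath_second a c h]
    exact single_mem_star _ ⟨by linarith, by linarith [ht.2]⟩

theorem endPath_zero (a c : Fin n) : endPath a c 0 = Pi.single a 1 := by
  rw [endPath_first a c (by norm_num)]
  norm_num

theorem single_one_injective : Function.Injective fun a : Fin n => (Pi.single a 1 : Fin n → ℝ) := by
  intro a b h
  by_contra hab
  have := congrFun h a
  simp [Pi.single_eq_of_ne hab] at this

end EndPath

namespace WordMap

variable {n : ℕ} (W : WordMap n)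

/-- The sum of the jumps along the first `k` steps of the word of leg `i`. -/
def jumpSum (l : Fin n) (φ : Fin n → ℝ) (i : Fin n) (k : ℕ) : ℝ :=
  ∑ j ∈ Finset.range k, jump l φ (W.letter i j) (W.letter i (j + 1))

/-- A word map is a code if its words are closed and reach only ends, and if for every label there
are weights whose jump sums distinguish the words from the closed prefixes of other words. -/
structure IsCode : Prop where
  depth_eq : ∀ i k, W.depth i k = 1
  letter_len : ∀ i, W.letter i (W.len i) = W.base
  separating : ∀ l, ∃ φ, ∀ a d k, k ≤ W.len a → W.letter a k = W.base →
    W.jumpSum l φ a k = W.jumpSum l φ d (W.len d) → a = d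

/-- The edges of the `k`-th subdivision of the complete graph on the ends, as paths in the star
together with the labels of their endpoints. -/
inductive IsEdge : ℕ → (ℝ → Fin n → ℝ) → Fin n → Fin n → Prop
  | endPath {a c : Fin n} : a ≠ c → IsEdge 0 (endPath a c) a c
  | step {k : ℕ} {σ : ℝ → Fin n → ℝ} {a c : Fin n} {j : ℕ} : IsEdge k σ a c → j < W.len c →
      IsEdge (k + 1) (fun t => σ (1 / 2 + (j + t) / (2 * W.len c)))
        (W.letter c j) (W.letter c (j + 1))
  | reverseStep {k : ℕ} {σ : ℝ → Fin n → ℝ} {a c : Fin n} {j : ℕ} : IsEdge k σ a c →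
      j < W.len c → IsEdge (k + 1) (fun t => σ (1 / 2 + (j + (1 - t)) / (2 * W.len c)))
        (W.letter c (j + 1)) (W.letter c j)

variable {W}

namespace IsEdge

theorem symm {k : ℕ} {σ : ℝ → Fin n → ℝ} {a c : Fin n} (h : W.IsEdge k σ a c) :
    W.IsEdge k (fun t => σ (1 - t)) c a := by
  cases h with
  | endPath h =>
    simp only [endPath_symm]
    exact .endPath h.symm
  | step h hj => exact .reverseStep h hj
  | reverseStep h hj =>
    simp only [sub_sub_cancel]
    exact .step h hj

theorem continuous {k : ℕ} {σ : ℝ → Fin n → ℝ} {a c : Fin n} (h : W.IsEdge k σ a c) :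
    Continuous σ := by
  induction h with
  | endPath h => exact continuous_endPath _ _
  | step h hj ih => exact ih.comp (by fun_prop)
  | reverseStep h hj ih => exact ih.comp (by fun_prop)

theorem param_mem {c : Fin n} {j : ℕ} (hj : j < W.len c) {t : ℝ} (ht : t ∈ Icc (0 : ℝ) 1) :
    (1 / 2 + (j + t) / (2 * W.len c) : ℝ) ∈ Icc (1 / 2 : ℝ) 1 := by
  have hL := W.len_pos' c
  have h1 : (j : ℝ) + 1 ≤ W.len c := by exact_mod_cast hj
  have h0 : (0 : ℝ) ≤ j := j.cast_nonneg
  have h2 : 0 ≤ (j + t) / (2 * W.len c) := div_nonneg (by linarith [ht.1]) (by linarith)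
  have h3 : (j + t) / (2 * W.len c) ≤ 1 / 2 := by
    rw [div_le_div_iff₀ (by linarith) (by norm_num)]
    linarith [ht.2]
  exact ⟨by linarith, by linarith⟩

theorem one_sub_mem {t : ℝ} (ht : t ∈ Icc (0 : ℝ) 1) : 1 - t ∈ Icc (0 : ℝ) 1 :=
  ⟨by linarith [ht.2], by linarith [ht.1]⟩

theorem mem_star {k : ℕ} {σ : ℝ → Fin n → ℝ} {a c : Fin n} (h : W.IsEdge k σ a c) {t : ℝ}
    (ht : t ∈ Icc (0 : ℝ) 1) : σ t ∈ star n := by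
  induction h generalizing t with
  | endPath h => exact endPath_mem_star _ _ ht
  | step h hj ih => exact ih ⟨by linarith [(param_mem hj ht).1], (param_mem hj ht).2⟩
  | reverseStep h hj ih =>
    have := param_mem hj (one_sub_mem ht)
    exact ih ⟨by linarith [this.1], this.2⟩

end IsEdge

/-- The points `σ (1/2 + j / (2 * len c))` on the second half of an edge. -/
noncomputable def node (W : WordMap n) (σ : ℝ → Fin n → ℝ) (c : Fin n) (j : ℕ) : Fin n → ℝ :=
  σ (1 / 2 + j / (2 * W.len c))

theorem node_zero (σ : ℝ → Fin n → ℝ) (c : Fin n) : W.node σ c 0 = σ (1 / 2) := by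
  simp [node]

theorem node_len (σ : ℝ → Fin n → ℝ) (c : Fin n) : W.node σ c (W.len c) = σ 1 := by
  have := W.len_pos' c
  rw [node]
  congr 1
  field_simp
  norm_num

namespace IsCode

variable (hC : W.IsCode)
include hC

theorem map_piece {i : Fin n} {k : ℕ} (hk : k < W.len i) {s : ℝ} (hs : s ∈ Icc (0 : ℝ) 1) :
    W.map (Pi.single i ((k + s) / W.len i)) =
      endPath (W.letter i k) (W.letter i (k + 1)) s := by
  rcases le_total s (1 / 2) with h | h
  · rw [W.map_first i hk.le hs.1 h, endPath_first _ _ h, hC.depth_eq, mul_one]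
  · rw [W.map_second i hk h hs.2, endPath_second _ _ h, hC.depth_eq, mul_one]

theorem iterate_edge {k : ℕ} {σ : ℝ → Fin n → ℝ} {a c : Fin n} (h : W.IsEdge k σ a c) {t : ℝ}
    (ht : t ∈ Icc (0 : ℝ) 1) : W.map^[k] (σ t) = endPath a c t := by
  have aux : ∀ (a c : Fin n) (j : ℕ), j < W.len c → ∀ t ∈ Icc (0 : ℝ) 1,
      W.map (endPath a c (1 / 2 + (j + t) / (2 * W.len c))) =
        endPath (W.letter c j) (W.letter c (j + 1)) t := by
    intro a c j hj t ht
    have hL := W.len_pos' c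
    rw [endPath_second _ _ (IsEdge.param_mem hj ht).1, ← hC.map_piece hj ht]
    congr 2
    field_simp
    ring
  induction h generalizing t with
  | endPath h => rfl
  | step h hj ih =>
    have hp := IsEdge.param_mem hj ht
    rw [Function.iterate_succ_apply', ih ⟨by linarith [hp.1], hp.2⟩, aux _ _ _ hj _ ht]
  | reverseStep h hj ih =>
    have hp := IsEdge.param_mem hj (IsEdge.one_sub_mem ht)
    rw [Function.iterate_succ_apply', ih ⟨by linarith [hp.1], hp.2⟩,
      aux _ _ _ hj _ (IsEdge.one_sub_mem ht), endPath_symm]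

end IsCode

/-- The vertices of the `k`-th subdivision, with their labels. -/
def IsNode (W : WordMap n) (k : ℕ) (x : Fin n → ℝ) (a : Fin n) : Prop :=
  ∃ σ c, W.IsEdge k σ a c ∧ x = σ 0

namespace IsEdge

variable {k : ℕ} {σ : ℝ → Fin n → ℝ} {a c : Fin n}

theorem left_isNode (h : W.IsEdge k σ a c) : W.IsNode k (σ 0) a := ⟨σ, c, h, rfl⟩

theorem right_isNode (h : W.IsEdge k σ a c) : W.IsNode k (σ 1) c :=
  ⟨_, a, h.symm, by simp⟩

/-- Consecutive points on the second half of an edge span an edge of the next subdivision. -/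
theorem exists_succ (h : W.IsEdge k σ a c) {j : ℕ} (hj : j < W.len c) :
    ∃ ρ, W.IsEdge (k + 1) ρ (W.letter c j) (W.letter c (j + 1)) ∧
      ρ 0 = W.node σ c j ∧ ρ 1 = W.node σ c (j + 1) :=
  ⟨_, .step h hj, by simp [node], by simp [node]⟩

theorem node_isNode (h : W.IsEdge k σ a c) {j : ℕ} (hj : j ≤ W.len c) :
    W.IsNode (k + 1) (W.node σ c j) (W.letter c j) := by
  rcases hj.lt_or_eq with hj | rfl
  · obtain ⟨ρ, hρ, h0, -⟩ := h.exists_succ hj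
    exact h0 ▸ hρ.left_isNode
  · obtain ⟨j, hj⟩ := Nat.exists_eq_succ_of_ne_zero (W.len_pos c).ne'
    obtain ⟨ρ, hρ, -, h1⟩ := h.exists_succ (j := j) (by omega)
    rw [hj, ← Nat.add_one, ← h1]
    exact hρ.right_isNode

end IsEdge

theorem IsNode.mem_star {k : ℕ} {x : Fin n → ℝ} {a : Fin n} (h : W.IsNode k x a) :
    x ∈ star n := by
  obtain ⟨σ, c, h, rfl⟩ := h
  exact h.mem_star (by simp)

theorem finite_isEdge (W : WordMap n) (k : ℕ) : {σ | ∃ a c, W.IsEdge k σ a c}.Finite := by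
  induction k with
  | zero =>
    refine (finite_range fun p : Fin n × Fin n => endPath p.1 p.2).subset ?_
    rintro σ ⟨a, c, h⟩
    cases h with
    | endPath h => exact ⟨(a, c), rfl⟩
  | succ k ih =>
    refine (ih.biUnion (t := fun σ => ⋃ c : Fin n, ⋃ j ∈ Finset.range (W.len c),
      {(fun t => σ (1 / 2 + (j + t) / (2 * W.len c))),
        (fun t => σ (1 / 2 + (j + (1 - t)) / (2 * W.len c)))}) fun σ _ =>
      finite_iUnion fun c => (Finset.finite_toSet _).biUnion fun j _ => by simp).subset ?_
    rintro σ ⟨a, c, h⟩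
    simp only [mem_iUnion, mem_insert_iff, mem_singleton_iff, Finset.mem_range]
    cases h with
    | step h hj => exact ⟨_, ⟨_, _, h⟩, _, _, hj, Or.inl rfl⟩
    | reverseStep h hj => exact ⟨_, ⟨_, _, h⟩, _, _, hj, Or.inr rfl⟩

theorem finite_isNode (W : WordMap n) (k : ℕ) : {x | ∃ a, W.IsNode k x a}.Finite := by
  refine ((W.finite_isEdge k).image fun σ => σ 0).subset ?_
  rintro _ ⟨a, σ, c, h, rfl⟩
  exact ⟨σ, ⟨a, c, h⟩, rfl⟩

/-- A function with equal values at the endpoints of every edge is constant on the vertices. -/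
theorem IsNode.eq_of_forall_edge {k : ℕ} (f : (Fin n → ℝ) → ℝ)
    (hf : ∀ σ a c, W.IsEdge k σ a c → f (σ 0) = f (σ 1)) {x y : Fin n → ℝ} {a c : Fin n}
    (hx : W.IsNode k x a) (hy : W.IsNode k y c) : f x = f y := by
  induction k generalizing x y a c with
  | zero =>
    have aux : ∀ {x a}, W.IsNode 0 x a → x = Pi.single a 1 := by
      rintro _ a ⟨σ, c, h, rfl⟩
      cases h with
      | endPath h => exact endPath_zero _ _
    rw [aux hx, aux hy]
    rcases eq_or_ne a c with rfl | hac
    · rfl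
    · have := hf _ _ _ (.endPath hac)
      rw [endPath_zero] at this
      rw [this, endPath_second _ _ (by norm_num)]
      norm_num
  | succ k ih =>
    have chain : ∀ {σ a c}, W.IsEdge k σ a c → ∀ j ≤ W.len c, f (W.node σ c j) = f (σ (1 / 2)) := by
      intro σ a c h j hj
      induction j with
      | zero => rw [node_zero]
      | succ j ihj =>
        obtain ⟨ρ, hρ, h0, h1⟩ := h.exists_succ (j := j) (by omega)
        rw [← ihj (by omega), ← h0, ← h1, hf _ _ _ hρ]
    have edge : ∀ {σ a c}, W.IsEdge k σ a c → f (σ 1) = f (σ (1 / 2)) := by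
      intro σ a c h
      rw [← node_len σ c, chain h _ le_rfl]
    have hedge : ∀ σ a c, W.IsEdge k σ a c → f (σ 0) = f (σ 1) := by
      intro σ a c h
      rw [edge h]
      have := edge h.symm
      norm_num at this
      exact this
    have proj : ∀ {x a}, W.IsNode (k + 1) x a → ∃ x' a', W.IsNode k x' a' ∧ f x = f x' := by
      rintro _ a ⟨ρ, c, h, rfl⟩
      cases h with
      | step h hj =>
        refine ⟨_, _, h.right_isNode, ?_⟩
        rw [edge h, ← chain h _ hj.le]
        simp [node]
      | reverseStep h hj =>
        refine ⟨_, _, h.right_isNode, ?_⟩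
        rw [edge h, ← chain h _ hj]
        simp [node]
    obtain ⟨x', a', hx', ex⟩ := proj hx
    obtain ⟨y', c', hy', ey⟩ := proj hy
    rw [ex, ey, ih hedge hx' hy']

end WordMap

namespace WordMap

variable {n : ℕ} {W : WordMap n}

theorem jumpSum_succ (l : Fin n) (φ : Fin n → ℝ) (i : Fin n) (k : ℕ) :
    W.jumpSum l φ i (k + 1) =
      W.jumpSum l φ i k + jump l φ (W.letter i k) (W.letter i (k + 1)) :=
  Finset.sum_range_succ _ _

theorem jumpSum_zero (l : Fin n) (φ : Fin n → ℝ) (i : Fin n) : W.jumpSum l φ i 0 = 0 :=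
  Finset.sum_range_zero _

theorem IsNode.iterate_map (hC : W.IsCode) {k : ℕ} {x : Fin n → ℝ} {a : Fin n}
    (h : W.IsNode k x a) : W.map^[k] x = Pi.single a 1 := by
  obtain ⟨σ, c, h, rfl⟩ := h
  rw [hC.iterate_edge h (by simp), endPath_zero]

theorem IsNode.label_unique (hC : W.IsCode) {k : ℕ} {x : Fin n → ℝ} {a b : Fin n}
    (ha : W.IsNode k x a) (hb : W.IsNode k x b) : a = b :=
  single_one_injective ((ha.iterate_map hC).symm.trans (hb.iterate_map hC))

theorem exists_label (hC : W.IsCode) (k : ℕ) :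
    ∃ lab : (Fin n → ℝ) → Fin n, ∀ x a, W.IsNode k x a → lab x = a := by
  have : ∀ x, ∃ b, ∀ a, W.IsNode k x a → b = a := by
    intro x
    by_cases h : ∃ b, W.IsNode k x b
    · exact ⟨h.choose, fun a ha => h.choose_spec.label_unique hC ha⟩
    · exact ⟨W.base, fun a ha => absurd ⟨a, ha⟩ h⟩
  choose lab hlab using this
  exact ⟨lab, hlab⟩

/-- The arc between the images of the endpoints of an edge contains only images of vertices with
the labels of the endpoints. -/
def SeparatesEdges (W : WordMap n) {m : ℕ} (h : (Fin n → ℝ) → (Fin m → ℝ)) (k : ℕ) : Prop :=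
  ∀ σ a c, W.IsEdge k σ a c → ∀ s d, W.IsNode k s d → h s ∈ between (h (σ 0)) (h (σ 1)) →
    d = a ∨ d = c

variable {m : ℕ} {h : (Fin n → ℝ) → (Fin m → ℝ)}

theorem separatesEdges_of_approx (hC : W.IsCode) {N : ℕ} {η ζ : ℝ} (hζ : 0 < ζ)
    (hη : 0 < η)
    (hstar : ∀ z ∈ star n, h z ∈ star m)
    (hcont : ∀ z ∈ star n, ∀ w ∈ star n, dist z w < ζ → dist (h z) (h w) < η / 2)
    (hsep : ∀ z ∈ star n, ∀ w ∈ star n, dist (h z) (h w) < η →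
      dist (W.map^[N] z) (W.map^[N] w) < 1) : W.SeparatesEdges h N := by
  intro σ a c hσ s d hs hbet
  have hu := (isCompact_Icc (a := (0 : ℝ)) (b := 1)).uniformContinuousOn_of_continuous
    hσ.continuous.continuousOn
  obtain ⟨δ, hδ, hu⟩ := Metric.uniformContinuousOn_iff.1 hu ζ hζ
  obtain ⟨M, hM⟩ := exists_nat_one_div_lt hδ
  have hM0 : (0 : ℝ) < M + 1 := by positivity
  set τ : ℕ → ℝ := fun i => min (i / (M + 1)) 1 with hτ
  have hτm : ∀ i, τ i ∈ Icc (0 : ℝ) 1 := fun i =>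
    ⟨le_min (by positivity) zero_le_one, min_le_right _ _⟩
  obtain ⟨i, -, hi⟩ := exists_mem_between_succ (f := fun i => h (σ (τ i)))
    (fun i => hstar _ (hσ.mem_star (hτm i))) (hstar _ hs.mem_star) M (by
      have h0 : τ 0 = 0 := by simp [hτ]
      have h1 : τ (M + 1) = 1 := by
        simp only [hτ, Nat.cast_add, Nat.cast_one, div_self hM0.ne', min_self]
      simpa only [h0, h1] using hbet)
  have hclose : dist (τ (i + 1)) (τ i) < δ := by
    refine lt_of_le_of_lt ?_ hM
    have : dist (min (((i + 1 : ℕ) : ℝ) / (M + 1)) 1) (min ((i : ℝ) / (M + 1)) 1) ≤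
        |((i + 1 : ℕ) : ℝ) / (M + 1) - (i : ℝ) / (M + 1)| := by
      simpa [Real.dist_eq] using abs_min_sub_min_le_max (((i + 1 : ℕ) : ℝ) / (M + 1)) 1
        ((i : ℝ) / (M + 1)) 1
    refine this.trans_eq ?_
    rw [← sub_div, Nat.cast_add, Nat.cast_one, add_sub_cancel_left, abs_of_pos (by positivity)]
  have h1 := hcont _ (hσ.mem_star (hτm (i + 1))) _ (hσ.mem_star (hτm i))
    (hu _ (hτm _) _ (hτm _) hclose)
  have h2 := dist_le_of_mem_between hi
  rw [dist_comm (h _)] at h1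
  have h3 := hsep _ hs.mem_star _ (hσ.mem_star (hτm i)) (by linarith)
  rw [hs.iterate_map hC, hC.iterate_edge hσ (hτm i)] at h3
  by_contra! hcon
  have := (dist_le_pi_dist _ _ d).trans_lt h3
  simp [endPath, Pi.single_eq_of_ne hcon.1, Pi.single_eq_of_ne hcon.2] at this

theorem SeparatesEdges.of_succ (hC : W.IsCode) (hmn : m < n)
    (hstar : ∀ z ∈ star n, h z ∈ star m) {k : ℕ} (hB : W.SeparatesEdges h (k + 1)) :
    W.SeparatesEdges h k := by
  classical
  obtain ⟨lab, hlab⟩ := exists_label hC (k + 1)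
  obtain ⟨lab', hlab'⟩ := exists_label hC k
  set P := (W.finite_isNode (k + 1)).toFinset with hP
  have memP : ∀ {x a}, W.IsNode (k + 1) x a → x ∈ P := fun hx => by
    rw [hP, Set.Finite.mem_toFinset]
    exact ⟨_, hx⟩
  have nodeP : ∀ {x}, x ∈ P → W.IsNode (k + 1) x (lab x) := fun {x} hx => by
    rw [hP, Set.Finite.mem_toFinset] at hx
    obtain ⟨a, ha⟩ := hx
    rwa [hlab _ _ ha]
  obtain ⟨l, hl⟩ := exists_potential hmn P h (fun p hp => hstar _ (nodeP hp).mem_star) lab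
  obtain ⟨φ, hφ⟩ := hC.separating l
  obtain ⟨U, hU⟩ := hl φ
  have chain : ∀ {σ a c}, W.IsEdge k σ a c → ∀ j ≤ W.len c,
      U (W.node σ c j) = U (σ (1 / 2)) + W.jumpSum l φ c j := by
    intro σ a c hσ j hj
    induction j with
    | zero => rw [node_zero, jumpSum_zero, add_zero]
    | succ j ih =>
      have n1 := hσ.node_isNode (j := j) (by omega)
      have n2 := hσ.node_isNode hj
      obtain ⟨ρ, hρ, h0, h1⟩ := hσ.exists_succ (j := j) (by omega)
      have := hU _ (memP n1) _ (memP n2) (W.letter c j) (W.letter c (j + 1))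
        fun q hq hb => hB ρ _ _ hρ q _ (nodeP hq) (by rwa [h0, h1])
      rw [hlab _ _ n1, hlab _ _ n2] at this
      rw [jumpSum_succ, ← add_assoc, ← ih (by omega)]
      linarith
  set V : (Fin n → ℝ) → ℝ := fun x => U x - W.jumpSum l φ (lab' x) (W.len (lab' x)) with hV
  have half : ∀ {σ a c}, W.IsEdge k σ a c → V (σ 1) = U (σ (1 / 2)) := by
    intro σ a c hσ
    have := chain hσ _ le_rfl
    rw [node_len] at this
    simp only [hV, hlab' _ _ hσ.right_isNode, this, add_sub_cancel_right]
  have hVedge : ∀ σ a c, W.IsEdge k σ a c → V (σ 0) = V (σ 1) := by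
    intro σ a c hσ
    have h2 := half hσ.symm
    norm_num at h2
    rw [half hσ, h2]
  have main : ∀ {σ a c}, W.IsEdge k σ a c → ∀ s d, W.IsNode k s d →
      h s ∈ between (h (σ (1 / 2))) (h (σ 1)) → d = c := by
    intro σ a c hσ s d hs hb
    obtain ⟨L, hL⟩ := Nat.exists_eq_succ_of_ne_zero (W.len_pos c).ne'
    obtain ⟨j, hj, hj'⟩ := exists_mem_between_succ (f := fun j => h (W.node σ c (min j (W.len c))))
      (fun j => hstar _ (hσ.node_isNode (min_le_right _ _)).mem_star) (hstar _ hs.mem_star) L (by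
        rw [hL]
        simp only [zero_min, Nat.succ_eq_add_one, min_self, node_zero]
        rwa [← Nat.succ_eq_add_one, ← hL, node_len])
    rw [min_eq_left (by omega), min_eq_left (by omega)] at hj'
    obtain ⟨ρ, hρ, h0, h1⟩ := hσ.exists_succ (j := j) (by omega)
    have sbase : W.IsNode (k + 1) s W.base := by
      obtain ⟨σ', c', hσ', rfl⟩ := hs
      have := hσ'.symm.node_isNode (le_refl _)
      rw [node_len, hC.letter_len] at this
      simpa using this
    have hUs : U s = V s + W.jumpSum l φ d (W.len d) := by
      simp only [hV, hlab' _ _ hs, sub_add_cancel]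
    have hVs : V s = U (σ (1 / 2)) := by
      rw [← half hσ]
      exact hs.eq_of_forall_edge V hVedge hσ.right_isNode
    have fin : ∀ i ≤ W.len c, W.letter c i = W.base →
        (∀ q ∈ P, h q ∈ between (h (W.node σ c i)) (h s) →
          lab q = W.letter c j ∨ lab q = W.letter c (j + 1)) → d = c := by
      intro i hi hbase hq
      have n1 := hσ.node_isNode hi
      have := hU _ (memP n1) _ (memP sbase) _ _ hq
      rw [hlab _ _ n1, hlab _ _ sbase, hbase] at this
      have h0 : jump l φ W.base W.base = 0 := by simp [jump]
      refine (hφ c d i hi hbase ?_).symm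
      have := chain hσ i hi
      linarith
    have hfull : ∀ q ∈ P, h q ∈ between (h (W.node σ c j)) (h (W.node σ c (j + 1))) →
        lab q = W.letter c j ∨ lab q = W.letter c (j + 1) := fun q hq hbq =>
      hB ρ _ _ hρ q _ (nodeP hq) (by rwa [h0, h1])
    rcases hB ρ _ _ hρ s _ sbase (by rwa [h0, h1]) with hb | hb
    · exact fin j (by omega) hb.symm fun q hq hbq => hfull q hq (between_subset_left hj' hbq)
    · refine fin (j + 1) (by omega) hb.symm fun q hq hbq => hfull q hq ?_
      rw [between_comm] at hj' ⊢
      exact between_subset_left hj' hbq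
  intro σ a c hσ s d hs hb
  have hmem : h (σ (1 / 2)) ∈ star m := hstar _ (hσ.mem_star (by norm_num))
  rcases between_subset_union (hstar _ hσ.left_isNode.mem_star) hmem
    (hstar _ hσ.right_isNode.mem_star) (hstar _ hs.mem_star) hb with hb | hb
  · left
    refine main hσ.symm s d hs ?_
    rw [between_comm] at hb
    norm_num at hb ⊢
    exact hb
  · exact Or.inr (main hσ s d hs hb)

theorem not_separatesEdges_zero (hn : 3 ≤ n) (hmn : m < n)
    (hstar : ∀ z ∈ star n, h z ∈ star m) : ¬ W.SeparatesEdges h 0 := by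
  intro hB
  have key : ∀ a c d : Fin n, a ≠ c →
      h (Pi.single d 1) ∈ between (h (Pi.single a 1)) (h (Pi.single c 1)) → d = a ∨ d = c := by
    intro a c d hac hb
    have hd : ∃ d' : Fin n, d ≠ d' := by
      rcases eq_or_ne d a with rfl | hda
      · exact ⟨c, hac⟩
      · exact ⟨a, hda⟩
    obtain ⟨d', hd'⟩ := hd
    refine hB _ a c (.endPath hac) _ d ⟨_, d', .endPath hd', (endPath_zero _ _).symm⟩ ?_
    rw [endPath_zero, endPath_second _ _ (by norm_num)]
    norm_num
    exact hb
  have hs : ∀ a : Fin n, ∃ (i : Fin m) (t : ℝ), 0 ≤ t ∧ h (Pi.single a 1) = Pi.single i t := by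
    intro a
    obtain ⟨i, t, ht, e⟩ := hstar _ (single_mem_star a (by simp : (1 : ℝ) ∈ Icc (0 : ℝ) 1))
    exact ⟨i, t, ht.1, e⟩
  choose i t ht e using hs
  obtain ⟨a, b, hab, hiab⟩ : ∃ a b, a ≠ b ∧ i a = i b := by
    by_contra! hcon
    have := Fintype.card_le_of_injective i fun a b hab => by
      by_contra hne
      exact hcon a b hne hab
    simp at this
    omega
  wlog hle : t a ≤ t b generalizing a b
  · exact this b a hab.symm hiab.symm (le_of_not_ge hle)
  obtain ⟨c, hca, hcb⟩ : ∃ c : Fin n, c ≠ a ∧ c ≠ b := by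
    have : ({a, b} : Finset (Fin n)) ≠ Finset.univ := by
      intro h
      have := congrArg Finset.card h
      rw [Finset.card_univ, Fintype.card_fin] at this
      have := Finset.card_le_two (a := a) (b := b)
      omega
    obtain ⟨c, hc⟩ : ∃ c, c ∉ ({a, b} : Finset (Fin n)) := by
      by_contra! hcon
      exact this (Finset.eq_univ_iff_forall.2 hcon)
    simp only [Finset.mem_insert, Finset.mem_singleton, not_or] at hc
    exact ⟨c, hc⟩
  have hcases : h (Pi.single a 1) ∈ between (h (Pi.single b 1)) (h (Pi.single c 1)) ∨
      h (Pi.single c 1) ∈ between (h (Pi.single a 1)) (h (Pi.single b 1)) ∨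
      h (Pi.single b 1) ∈ between (h (Pi.single a 1)) (h (Pi.single c 1)) := by
    rw [e a, e b, e c, ← hiab]
    rcases eq_or_ne (i a) (i c) with hic | hic
    · rw [← hic]
      rcases le_total (t c) (t a) with h1 | h1
      · exact Or.inl (mem_between_single_same (mem_uIcc.2 (Or.inr ⟨h1, hle⟩)))
      · rcases le_total (t c) (t b) with h2 | h2
        · exact Or.inr (Or.inl (mem_between_single_same (mem_uIcc.2 (Or.inl ⟨h1, h2⟩))))
        · exact Or.inr (Or.inr (mem_between_single_same (mem_uIcc.2 (Or.inl ⟨hle, h2⟩))))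
    · exact Or.inl (mem_between_single_left hic (ht a) hle (ht c))
  rcases hcases with hc | hc | hc
  · rcases key b c a hcb.symm hc with h | h
    · exact hab h
    · exact hca h.symm
  · rcases key a b c hab hc with h | h
    · exact hca h
    · exact hcb h
  · rcases key a c b hca.symm hc with h | h
    · exact hab h.symm
    · exact hcb h.symm

theorem IsCode.not_isLike (hC : W.IsCode) (hW : W.IsExpanding) (hn : 3 ≤ n) (hmn : m < n) :
    letI := W.limitMetric; ¬ IsLike W.limit (simpleOdSet m) := by
  intro hlike
  obtain ⟨N, η, ζ, h, hη, hζ, hstar, hcont, hsep⟩ := hW.exists_approx hlike one_pos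
  have hN := separatesEdges_of_approx hC hζ hη hstar hcont hsep
  have : ∀ k, W.SeparatesEdges h k → False := by
    intro k
    induction k with
    | zero => exact not_separatesEdges_zero hn hmn hstar
    | succ k ih => exact fun hB => ih (hB.of_succ hC hmn hstar)
  exact this N hN

end WordMap

namespace WordMap

theorem isExpanding_of_depth_eq_one {n : ℕ} {W : WordMap n} (hd : ∀ i k, W.depth i k = 1)
    (hs : ∀ i j, ∃ k ≤ W.len i, W.letter i k = j) : W.IsExpanding := by
  have hend : ∀ i, ∃ j, W.map (Pi.single i 1) = Pi.single j 1 := by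
    intro i
    have := W.map_vertex i (le_refl _)
    rw [div_self (W.len_pos' i).ne', hd] at this
    exact ⟨_, this⟩
  have hsurj : ∀ i, ∀ y ∈ star n, ∃ t ∈ Icc (0 : ℝ) 1, W.map (Pi.single i t) = y := by
    rintro i y ⟨j, r, hr, rfl⟩
    obtain ⟨k, hk, rfl⟩ := hs i j
    exact W.exists_map_eq i hk (by rwa [hd])
  refine ⟨hend, fun i k hk => ?_, fun i y hy => ?_⟩
  · rw [W.map_vertex i hk, hd]
    exact hend _
  · obtain ⟨s, hs, rfl⟩ := hsurj i y hy
    obtain ⟨t, ht, h⟩ := hsurj i _ (single_mem_star i hs)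
    exact ⟨t, ht, by rw [h]⟩

end WordMap

/-! ### A code with at least four legs -/

section Cycles

variable {n : ℕ}

theorem sum_jump_cycle (σ : ℕ → Fin n) (hper : ∀ j, σ (j + n) = σ j)
    (hinj : ∀ i < n, ∀ j < n, σ i = σ j → i = j) (φ : Fin n → ℝ) {q : ℕ} (hq : q < n) :
    ∑ j ∈ Finset.range n, jump (σ (q + 1)) φ (σ j) (σ (j + 1)) = φ (σ q) - φ (σ (q + 2)) := by
  have hsucc : ∀ i < n, ∀ j < n, σ (i + 1) = σ (j + 1) → i = j := by
    have aux : ∀ i < n, ∃ r < n, σ (i + 1) = σ r ∧ (r = i + 1 ∨ r = 0 ∧ i + 1 = n) := by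
      intro i hi
      rcases Nat.lt_or_ge (i + 1) n with h | h
      · exact ⟨i + 1, h, rfl, Or.inl rfl⟩
      · have : i + 1 = 0 + n := by omega
        exact ⟨0, by omega, by rw [this, hper], Or.inr ⟨rfl, by omega⟩⟩
    intro i hi j hj h
    obtain ⟨r, hr, e, hr'⟩ := aux i hi
    obtain ⟨s, hs, e', hs'⟩ := aux j hj
    have := hinj r hr s hs (by rw [← e, ← e', h])
    omega
  simp only [jump, Finset.sum_sub_distrib]
  congr 1
  · rw [Finset.sum_eq_single q]
    · simp
    · intro j hj hjq
      rw [if_neg]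
      exact fun h => hjq (hsucc j (Finset.mem_range.1 hj) q hq h)
    · simp [hq]
  · obtain ⟨r, hr, e, e'⟩ : ∃ r < n, σ (q + 1) = σ r ∧ σ (q + 2) = σ (r + 1) := by
      rcases Nat.lt_or_ge (q + 1) n with h | h
      · exact ⟨q + 1, h, rfl, rfl⟩
      · refine ⟨0, by omega, ?_, ?_⟩
        · rw [show q + 1 = 0 + n by omega, hper]
        · rw [show q + 2 = 0 + 1 + n by omega, hper]
    rw [Finset.sum_eq_single r]
    · simp [e, e']
    · intro j hj hjr
      rw [if_neg]
      rw [e]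
      exact fun h => hjr (hinj j (Finset.mem_range.1 hj) r hr h)
    · simp [hr]

variable [NeZero n]

/-- The cyclic sequence `0, 1, 2, …, n - 1`. -/
def rotation (n : ℕ) [NeZero n] (k : ℕ) : Fin n := ⟨k % n, Nat.mod_lt _ (NeZero.pos n)⟩

/-- The cyclic sequence `0, 2, 4, …, 1, 3, 5, …`. -/
def shuffle (n : ℕ) [NeZero n] (k : ℕ) : Fin n :=
  ⟨if 2 * (k % n) < n then 2 * (k % n) else 2 * (k % n - (n + 1) / 2) + 1, by
    have := Nat.mod_lt k (NeZero.pos n)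
    split_ifs <;> omega⟩

theorem rotation_add (k : ℕ) : rotation n (k + n) = rotation n k := by simp [rotation]

theorem shuffle_add (k : ℕ) : shuffle n (k + n) = shuffle n k := by simp [shuffle]

theorem rotation_inj : ∀ i < n, ∀ j < n, rotation n i = rotation n j → i = j := by
  intro i hi j hj h
  simpa [rotation, Nat.mod_eq_of_lt hi, Nat.mod_eq_of_lt hj] using h

theorem val_shuffle {k : ℕ} (hk : k < n) :
    (shuffle n k : ℕ) = if 2 * k < n then 2 * k else 2 * (k - (n + 1) / 2) + 1 := by
  simp [shuffle, Nat.mod_eq_of_lt hk]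

theorem shuffle_inj : ∀ i < n, ∀ j < n, shuffle n i = shuffle n j → i = j := by
  intro i hi j hj h
  have := congrArg Fin.val h
  rw [val_shuffle hi, val_shuffle hj] at this
  split_ifs at this <;> omega

omit [NeZero n] in
theorem ne_add_of_periodic {σ : ℕ → Fin n} (hper : ∀ j, σ (j + n) = σ j)
    (hinj : ∀ i < n, ∀ j < n, σ i = σ j → i = j) {d : ℕ} (hd : 0 < d) (hdn : d < n) (k : ℕ) :
    σ k ≠ σ (k + d) := by
  have hmod : ∀ k, σ k = σ (k % n) := fun k => (Function.Periodic.map_mod_nat hper k).symm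
  intro h
  rw [hmod k, hmod (k + d)] at h
  have h1 : k + 0 ≡ k + d [MOD n] :=
    hinj _ (Nat.mod_lt _ (by omega)) _ (Nat.mod_lt _ (by omega)) h
  have h2 := Nat.ModEq.add_left_cancel' k h1
  rw [Nat.ModEq, Nat.zero_mod, Nat.mod_eq_of_lt hdn] at h2
  omega

theorem exists_rotation_eq (hn : 2 ≤ n) (l : Fin n) : ∃ p < n, rotation n (p + 1) = l ∧
    (rotation n p : ℕ) = (if (l : ℕ) = 0 then n - 1 else (l : ℕ) - 1) ∧
    (rotation n (p + 2) : ℕ) = if (l : ℕ) + 1 = n then 0 else (l : ℕ) + 1 := by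
  have hval : ∀ {k}, k < n → (rotation n k : ℕ) = k := fun hk => Nat.mod_eq_of_lt hk
  have hval' : ∀ {k}, k < n → (rotation n (k + n) : ℕ) = k := fun hk => by
    rw [rotation_add, hval hk]
  have hl := l.isLt
  rcases Nat.eq_zero_or_pos (l : ℕ) with h | h
  · refine ⟨n - 1, by omega, Fin.ext ?_, ?_, ?_⟩
    · rw [show n - 1 + 1 = 0 + n by omega, hval' (by omega), h]
    · rw [hval (by omega), if_pos h]
    · rw [show n - 1 + 2 = 1 + n by omega, hval' (by omega), if_neg (by omega)]
      omega
  · refine ⟨l - 1, by omega, Fin.ext ?_, ?_, ?_⟩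
    · rw [show (l : ℕ) - 1 + 1 = l by omega, hval hl]
    · rw [hval (by omega), if_neg (by omega)]
    · rw [show (l : ℕ) - 1 + 2 = l + 1 by omega]
      split_ifs with h1
      · rw [show (l : ℕ) + 1 = 0 + n by omega, hval' (by omega)]
      · rw [hval (by omega)]

theorem exists_shuffle_eq (hn : 4 ≤ n) (l : Fin n) : ∃ q < n, shuffle n (q + 1) = l ∧
    ((shuffle n q : ℕ) + 2 = l ∨ (l : ℕ) < 2 ∧ (shuffle n (q + 2) : ℕ) = l + 2) := by
  have hl := l.isLt
  have hval' : ∀ {k}, k < n → (shuffle n (k + n) : ℕ) =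
      if 2 * k < n then 2 * k else 2 * (k - (n + 1) / 2) + 1 := fun hk => by
    rw [shuffle_add, val_shuffle hk]
  rcases Nat.lt_or_ge (l : ℕ) 2 with h | h
  · rcases Nat.eq_zero_or_pos (l : ℕ) with h0 | h0
    · refine ⟨n - 1, by omega, Fin.ext ?_, Or.inr ⟨h, ?_⟩⟩
      · rw [show n - 1 + 1 = 0 + n by omega, hval' (by omega), if_pos (by omega)]
        omega
      · rw [show n - 1 + 2 = 1 + n by omega, hval' (by omega), if_pos (by omega)]
        omega
    · refine ⟨(n + 1) / 2 - 1, by omega, Fin.ext ?_, Or.inr ⟨h, ?_⟩⟩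
      · rw [val_shuffle (by omega), if_neg (by omega)]
        omega
      · rw [val_shuffle (by omega), if_neg (by omega)]
        omega
  · rcases Nat.even_or_odd' (l : ℕ) with ⟨k, hk | hk⟩
    · refine ⟨k - 1, by omega, Fin.ext ?_, Or.inl ?_⟩
      · rw [val_shuffle (by omega), if_pos (by omega)]
        omega
      · rw [val_shuffle (by omega), if_pos (by omega)]
        omega
    · refine ⟨(n + 1) / 2 + k - 1, by omega, Fin.ext ?_, Or.inl ?_⟩
      · rw [val_shuffle (by omega), if_neg (by omega)]
        omega
      · rw [val_shuffle (by omega), if_neg (by omega)]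
        omega

theorem exists_weights (hn : 4 ≤ n) (l : Fin n) : ∃ φ : Fin n → ℝ,
    ∑ j ∈ Finset.range n, jump l φ (rotation n j) (rotation n (j + 1)) = 1 ∧
    (n : ℝ) < |∑ j ∈ Finset.range n, jump l φ (shuffle n j) (shuffle n (j + 1))| := by
  have hl := l.isLt
  have hn' : (4 : ℝ) ≤ n := by exact_mod_cast hn
  obtain ⟨p, hp, hpl, hp1, hp2⟩ := exists_rotation_eq (by omega) l
  obtain ⟨q, hq, hql, hq'⟩ := exists_shuffle_eq hn l
  have hp3 : rotation n p ≠ rotation n (p + 2) :=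
    ne_add_of_periodic rotation_add rotation_inj (by omega) (by omega) p
  have hq3 : shuffle n q ≠ shuffle n (q + 2) :=
    ne_add_of_periodic shuffle_add shuffle_inj (by omega) (by omega) q
  have hA := fun φ => sum_jump_cycle (rotation n) rotation_add rotation_inj φ hp
  have hB := fun φ => sum_jump_cycle (shuffle n) shuffle_add shuffle_inj φ hq
  rw [hpl] at hA
  rw [hql] at hB
  obtain ⟨x, hx1, hx2, hx⟩ : ∃ x, x ≠ rotation n p ∧ x ≠ rotation n (p + 2) ∧
      (x = shuffle n q ∨ x = shuffle n (q + 2)) := by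
    rcases hq' with h | ⟨h1, h2⟩
    · refine ⟨shuffle n q, fun e => ?_, fun e => ?_, Or.inl rfl⟩ <;>
      · rw [e] at h
        split_ifs at hp1 hp2 <;> omega
    · refine ⟨shuffle n (q + 2), fun e => ?_, fun e => ?_, Or.inr rfl⟩ <;>
      · rw [e] at h2
        split_ifs at hp1 hp2 <;> omega
  refine ⟨fun i => (if i = rotation n p then 1 else 0) + if i = x then 3 * (n : ℝ) else 0, ?_, ?_⟩
  · rw [hA, if_pos rfl, if_neg hx1.symm, if_neg hp3.symm, if_neg hx2.symm]
    ring
  · rw [hB]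
    rcases hx with rfl | rfl
    · rw [if_neg hx1, if_pos rfl, if_neg hq3.symm, lt_abs]
      left
      split_ifs <;> linarith
    · rw [if_neg hx1, if_pos rfl, if_neg hq3, lt_abs]
      right
      split_ifs <;> linarith

/-- The word of the leg `d` is `d + 1` rounds of the rotation followed by one of the shuffle. -/
noncomputable def codeWord (hn : 2 ≤ n) : WordMap n where
  base := rotation n 0
  len d := n * (d + 2)
  letter d k := if k ≤ n * (d + 1) then rotation n k else shuffle n k
  depth _ _ := 1
  len_pos d := Nat.mul_pos (by omega) (by omega)
  depth_pos _ _ := one_pos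
  depth_le _ _ := le_rfl
  letter_zero d := by simp
  depth_zero _ := rfl
  letter_ne d k _ := by
    have h0 : shuffle n (n * (d + 1)) = rotation n (n * (d + 1)) := by
      simp [shuffle, rotation, NeZero.pos n]
    have hA := ne_add_of_periodic (n := n) rotation_add rotation_inj one_pos (by omega) k
    have hB := ne_add_of_periodic (n := n) shuffle_add shuffle_inj one_pos (by omega) k
    rcases lt_trichotomy k (n * ((d : ℕ) + 1)) with h | h | h
    · rwa [if_pos h.le, if_pos (Nat.succ_le_of_lt h)]
    · rw [if_pos h.le, if_neg (by omega)]
      rw [h] at hB ⊢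
      rwa [← h0]
    · rwa [if_neg (by omega), if_neg (by omega)]

theorem isExpanding_codeWord (hn : 2 ≤ n) : (codeWord hn).IsExpanding := by
  refine WordMap.isExpanding_of_depth_eq_one (fun _ _ => rfl) fun i j => ⟨j, ?_, ?_⟩
  · exact j.isLt.le.trans (Nat.le_mul_of_pos_right _ (by omega))
  · have : (j : ℕ) ≤ n * ((i : ℕ) + 1) := j.isLt.le.trans (Nat.le_mul_of_pos_right _ (by omega))
    simp only [codeWord, if_pos this]
    exact Fin.ext (Nat.mod_eq_of_lt j.isLt)

theorem jumpSum_codeWord (hn : 2 ≤ n) (l : Fin n) (φ : Fin n → ℝ) (d : Fin n) {j : ℕ}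
    (hj : j ≤ (d : ℕ) + 1) : (codeWord hn).jumpSum l φ d (n * j) =
      j * ∑ k ∈ Finset.range n, jump l φ (rotation n k) (rotation n (k + 1)) := by
  induction j with
  | zero => simp [WordMap.jumpSum]
  | succ j ih =>
    have := ih (by omega)
    have h1 : n * (j + 1) ≤ n * (d + 1) := Nat.mul_le_mul_left _ hj
    rw [WordMap.jumpSum] at this ⊢
    rw [Nat.mul_succ, Finset.sum_range_add, this, Nat.cast_succ, add_one_mul]
    congr 1
    refine Finset.sum_congr rfl fun k hk => ?_
    have hk := Finset.mem_range.1 hk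
    rw [Nat.mul_succ] at h1
    simp only [codeWord]
    rw [if_pos (by omega), if_pos (by omega)]
    simp [rotation, add_assoc]

theorem jumpSum_codeWord_len (hn : 2 ≤ n) (l : Fin n) (φ : Fin n → ℝ) (d : Fin n) :
    (codeWord hn).jumpSum l φ d ((codeWord hn).len d) =
      ((d : ℕ) + 1) * ∑ k ∈ Finset.range n, jump l φ (rotation n k) (rotation n (k + 1)) +
        ∑ k ∈ Finset.range n, jump l φ (shuffle n k) (shuffle n (k + 1)) := by
  have h0 : rotation n (n * (d + 1)) = shuffle n 0 := by
    simp [shuffle, rotation, NeZero.pos n]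
  have := jumpSum_codeWord hn l φ d le_rfl
  have hlen : (codeWord hn).len d = n * (d + 1) + n := by simp [codeWord]; ring
  rw [hlen]
  rw [WordMap.jumpSum] at this ⊢
  rw [Finset.sum_range_add, this, Nat.cast_succ]
  congr 1
  refine Finset.sum_congr rfl fun k hk => ?_
  have aux : ∀ k, (codeWord hn).letter d (n * (d + 1) + k) = shuffle n k := by
    intro k
    simp only [codeWord]
    split_ifs with h
    · rw [show k = 0 by omega]
      exact h0
    · simp [shuffle]
  rw [add_assoc, aux, aux]

theorem isCode_codeWord (hn : 4 ≤ n) : (codeWord (n := n) (by omega)).IsCode := by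
  refine ⟨fun _ _ => rfl, fun i => ?_, fun l => ?_⟩
  · simp only [codeWord]
    have : n * ((i : ℕ) + 2) = n * (i + 1) + n := by ring
    rw [if_neg (by omega)]
    simp [shuffle, rotation, NeZero.pos n]
  obtain ⟨φ, hφ1, hφ2⟩ := exists_weights hn l
  refine ⟨φ, fun a d k hk hbase hsum => ?_⟩
  rw [jumpSum_codeWord_len, hφ1] at hsum
  have hdvd : n ∣ k := by
    simp only [codeWord] at hbase
    split_ifs at hbase with h
    · exact Nat.dvd_of_mod_eq_zero (by simpa [rotation] using hbase)
    · have h0 : shuffle n 0 = rotation n 0 := by simp [shuffle, rotation, NeZero.pos n]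
      have hmod : shuffle n (k % n) = shuffle n 0 := by
        rw [h0, ← hbase]
        simp [shuffle]
      exact Nat.dvd_of_mod_eq_zero (shuffle_inj _ (Nat.mod_lt _ (by omega)) _ (by omega) hmod)
  obtain ⟨j, rfl⟩ := hdvd
  have hj : j ≤ a + 2 := Nat.le_of_mul_le_mul_left hk (by omega)
  rcases hj.lt_or_eq with hj | rfl
  · rw [jumpSum_codeWord _ _ _ _ (by omega), hφ1] at hsum
    have h1 : (j : ℝ) ≤ n := by exact_mod_cast (by omega : j ≤ n)
    have h2 : ((d : ℕ) : ℝ) + 1 ≤ n := by exact_mod_cast d.isLt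
    have h3 : (0 : ℝ) ≤ j := j.cast_nonneg
    have h4 : (0 : ℝ) ≤ (d : ℕ) := Nat.cast_nonneg _
    rcases lt_abs.1 hφ2 with h | h <;> linarith
  · have := jumpSum_codeWord_len (n := n) (by omega) l φ a
    rw [hφ1] at this
    have h : (codeWord (n := n) (by omega)).jumpSum l φ a (n * (a + 2)) = _ := this
    rw [h] at hsum
    have : ((a : ℕ) : ℝ) = (d : ℕ) := by linarith
    exact Fin.ext (by exact_mod_cast this)

end Cycles

/-! ### A word map with three legs -/

/-- The letters of the word map with three legs. -/
def threeLetter : Fin 3 → ℕ → Fin 3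
  | _, 0 => 0
  | 0, 1 => 1
  | 1, 1 => 2
  | 2, 1 => 1
  | i, _ => i

/-- The word map with three legs: all words have two steps, and the middle point of the last leg
is mapped to the middle point of the second leg, all other vertices to ends. -/
noncomputable def threeWord : WordMap 3 where
  base := 0
  len _ := 2
  letter := threeLetter
  depth i k := if i = 2 ∧ k = 1 then 1 / 2 else 1
  len_pos _ := two_pos
  depth_pos i k := by split_ifs <;> norm_num
  depth_le i k := by split_ifs <;> norm_num
  letter_zero i := by simp [threeLetter]
  depth_zero i := by simp
  letter_ne i k hk := by
    interval_cases k <;> fin_cases i <;> decide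

theorem threeWord_map_vertex (i : Fin 3) {k : ℕ} (hk : k ≤ 2) : threeWord.map
    (Pi.single i (k / 2)) = Pi.single (threeLetter i k) (if i = 2 ∧ k = 1 then 1 / 2 else 1) := by
  have := threeWord.map_vertex i (k := k) hk
  simpa [threeWord] using this

theorem threeWord_map_end (i : Fin 3) : threeWord.map (Pi.single i 1) = Pi.single i 1 := by
  have := threeWord_map_vertex i (k := 2) le_rfl
  have h : threeLetter i 2 = i := by fin_cases i <;> rfl
  simpa [h] using this

theorem threeWord_exists_map_eq (i : Fin 3) {k : ℕ} (hk : k ≤ 2) {j : Fin 3}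
    (hj : threeLetter i k = j) (h : ¬(i = 2 ∧ k = 1)) {r : ℝ} (hr : r ∈ Icc (0 : ℝ) 1) :
    ∃ t ∈ Icc (0 : ℝ) 1, threeWord.map (Pi.single i t) = Pi.single j r := by
  subst hj
  exact threeWord.exists_map_eq i (k := k) hk (by simpa [threeWord, h] using hr)

theorem isExpanding_threeWord : threeWord.IsExpanding := by
  refine ⟨fun i => ⟨i, threeWord_map_end i⟩, fun i k hk => ?_, fun i y hy => ?_⟩
  · change k ≤ 2 at hk
    have := threeWord_map_vertex i hk
    change ∃ j, threeWord.map (threeWord.map (Pi.single i ((k : ℝ) / ((2 : ℕ) : ℝ)))) = _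
    rw [Nat.cast_two, this]
    split_ifs with h
    · obtain ⟨rfl, rfl⟩ := h
      have := threeWord_map_vertex 1 (k := 1) (by norm_num)
      refine ⟨2, ?_⟩
      simpa [threeLetter] using this
    · exact ⟨_, threeWord_map_end _⟩
  · have step : ∀ {i k j} (_ : k ≤ 2) (_ : threeLetter i k = j) (_ : ¬(i = 2 ∧ k = 1))
        {s : ℝ} (_ : s ∈ Icc (0 : ℝ) 1) (_ : threeWord.map (Pi.single j s) = y),
        ∃ t ∈ Icc (0 : ℝ) 1, threeWord.map (threeWord.map (Pi.single i t)) = y := by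
      intro i k j hk hj h s hs e
      obtain ⟨t, ht, e'⟩ := threeWord_exists_map_eq i hk hj h hs
      exact ⟨t, ht, by rw [e', e]⟩
    obtain ⟨j, r, hr, rfl⟩ := hy
    have h1 : ∃ s ∈ Icc (0 : ℝ) 1, threeWord.map (Pi.single 1 s) = Pi.single j r := by
      fin_cases j
      · exact threeWord_exists_map_eq 1 (k := 0) (by norm_num) rfl (by decide) hr
      · exact threeWord_exists_map_eq 1 (k := 2) (by norm_num) rfl (by decide) hr
      · exact threeWord_exists_map_eq 1 (k := 1) (by norm_num) rfl (by decide) hr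
    obtain ⟨s, hs, e⟩ := h1
    fin_cases i
    · exact step (k := 1) (by norm_num) rfl (by decide) hs e
    · exact step (k := 2) (by norm_num) rfl (by decide) hs e
    · fin_cases j
      · obtain ⟨s, hs, e⟩ :=
          threeWord_exists_map_eq 0 (k := 0) (by norm_num) rfl (by decide) hr
        exact step (k := 0) (by norm_num) rfl (by decide) hs e
      · obtain ⟨s, hs, e⟩ :=
          threeWord_exists_map_eq 0 (k := 1) (by norm_num) rfl (by decide) hr
        exact step (k := 0) (by norm_num) rfl (by decide) hs e
      · obtain ⟨s, hs, e⟩ :=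
          threeWord_exists_map_eq 2 (k := 2) (by norm_num) rfl (by decide) hr
        exact step (k := 2) (by norm_num) rfl (by decide) hs e

/-! ### Interchanging two points of the star with three legs -/

/-- The point at parameter `s` of a half of a leg; `(i, 0)` is the half of the leg `i` at the
branch point and `(i, 1)` is the half at the end. -/
noncomputable def halfPoint (c : Fin 3 × ℕ) (s : ℝ) : Fin 3 → ℝ := Pi.single c.1 ((c.2 + s) / 2)

theorem continuous_halfPoint (c : Fin 3 × ℕ) : Continuous (halfPoint c) :=
  (continuous_single_real c.1).comp (by fun_prop)

/-- The parameters of pairs of points of two halves of legs that are separated by an iterate. -/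
def separatedSet (k : ℕ) (c d : Fin 3 × ℕ) : Set (ℝ × ℝ) :=
  {p | p.1 ∈ Icc (0 : ℝ) 1 ∧ p.2 ∈ Icc (0 : ℝ) 1 ∧
    1 / 4 ≤ dist (threeWord.map^[k] (halfPoint c p.1)) (threeWord.map^[k] (halfPoint d p.2))}

/-- Two pairs of points, with parameters counted in quarters, are joined by a path of separated
pairs. -/
def Link (k : ℕ) (c d : Fin 3 × ℕ) (x y x' y' : ℕ) : Prop :=
  JoinedIn (separatedSet k c d) ((x : ℝ) / 4, (y : ℝ) / 4) ((x' : ℝ) / 4, (y' : ℝ) / 4)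

theorem Link.trans {k : ℕ} {c d : Fin 3 × ℕ} {x y x' y' x'' y'' : ℕ} (h₁ : Link k c d x y x' y')
    (h₂ : Link k c d x' y' x'' y'') : Link k c d x y x'' y'' :=
  JoinedIn.trans h₁ h₂

/-- A link between pairs of endpoints; the Boolean values choose the endpoints. -/
def Move (k : ℕ) (c d : Fin 3 × ℕ) (x y z w : Bool) : Prop :=
  Link k c d (cond x 4 0) (cond y 4 0) (cond z 4 0) (cond w 4 0)

/-- The half `c'` of a leg is the image of the part of `c` between the quarters `a` and `b`. -/
def Branch (c c' : Fin 3 × ℕ) (a b : ℕ) : Prop :=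
  a ≤ 4 ∧ b ≤ 4 ∧ ∀ s ∈ Icc (0 : ℝ) 1,
    threeWord.map (halfPoint c (((1 - s) * a + s * b) / 4)) = halfPoint c' s

namespace Move

variable {k : ℕ} {c d : Fin 3 × ℕ} {x y x' y' : Bool}

theorem symm (h : Move k c d x y x' y') : Move k c d x' y' x y := JoinedIn.symm h

theorem swap (h : Move k c d x y x' y') : Move k d c y x y' x' := by
  refine (JoinedIn.map h continuous_swap).mono ?_
  rintro _ ⟨p, ⟨h1, h2, h3⟩, rfl⟩
  exact ⟨h2, h1, by rwa [dist_comm] at h3⟩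

theorem lift {c' d' : Fin 3 × ℕ} {a b a' b' : ℕ} (h : Move k c' d' x y x' y')
    (hb : Branch c c' a b) (hb' : Branch d d' a' b') :
    Link (k + 1) c d (cond x b a) (cond y b' a') (cond x' b a) (cond y' b' a') := by
  have hf : Continuous fun p : ℝ × ℝ =>
      (((1 - p.1) * a + p.1 * b) / 4, ((1 - p.2) * a' + p.2 * b') / 4) := by fun_prop
  have aux : ∀ {a b : ℕ} {s : ℝ}, a ≤ 4 → b ≤ 4 → s ∈ Icc (0 : ℝ) 1 →
      ((1 - s) * a + s * b) / 4 ∈ Icc (0 : ℝ) 1 := by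
    intro a b s ha hb hs
    have ha' : (a : ℝ) ≤ 4 := by exact_mod_cast ha
    have hb' : (b : ℝ) ≤ 4 := by exact_mod_cast hb
    have h0 : (0 : ℝ) ≤ a := a.cast_nonneg
    have h0' : (0 : ℝ) ≤ b := b.cast_nonneg
    constructor
    · have := mul_nonneg (sub_nonneg.2 hs.2) h0
      have := mul_nonneg hs.1 h0'
      linarith
    · have := mul_le_mul_of_nonneg_left ha' (sub_nonneg.2 hs.2)
      have := mul_le_mul_of_nonneg_left hb' hs.1
      linarith
  have key := JoinedIn.map h hf
  replace key := key.mono (V := separatedSet (k + 1) c d) <| by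
    rintro _ ⟨p, ⟨h1, h2, h3⟩, rfl⟩
    refine ⟨aux hb.1 hb.2.1 h1, aux hb'.1 hb'.2.1 h2, ?_⟩
    rw [Function.iterate_succ_apply, Function.iterate_succ_apply, hb.2.2 _ h1, hb'.2.2 _ h2]
    exact h3
  cases x <;> cases y <;> cases x' <;> cases y' <;> simpa [Link] using key

end Move

theorem threeWord_map_first (i : Fin 3) (k : ℕ) (hk : k ≤ 1) {s : ℝ} (hs : 0 ≤ s)
    (hs' : s ≤ 1 / 2) : threeWord.map (halfPoint (i, k) s) =
      Pi.single (threeLetter i k) ((1 - 2 * s) * if i = 2 ∧ k = 1 then 1 / 2 else 1) :=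
  threeWord.map_first i (k := k) (hk.trans one_le_two) hs hs'

theorem threeWord_map_second (i : Fin 3) (k : ℕ) (hk : k ≤ 1) {s : ℝ} (hs : 1 / 2 ≤ s)
    (hs' : s ≤ 1) : threeWord.map (halfPoint (i, k) s) =
      Pi.single (threeLetter i (k + 1))
        ((2 * s - 1) * if i = 2 ∧ k + 1 = 1 then 1 / 2 else 1) :=
  threeWord.map_second i (k := k) (Nat.lt_succ_of_le hk) hs hs'

theorem branch_first_outer (i : Fin 3) (k : ℕ) (hk : k ≤ 1 := by decide)
    (h : ¬(i = 2 ∧ k = 1) := by decide) : Branch (i, k) (threeLetter i k, 1) 1 0 := by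
  refine ⟨by norm_num, by norm_num, fun s hs => ?_⟩
  obtain ⟨h0, h1⟩ := hs
  norm_num
  rw [threeWord_map_first i k hk (by linarith) (by linarith), if_neg h, halfPoint]
  congr 1
  push_cast
  ring

theorem branch_first_inner (i : Fin 3) (k : ℕ) (hk : k ≤ 1 := by decide)
    (h : ¬(i = 2 ∧ k = 1) := by decide) : Branch (i, k) (threeLetter i k, 0) 2 1 := by
  refine ⟨by norm_num, by norm_num, fun s hs => ?_⟩
  obtain ⟨h0, h1⟩ := hs
  norm_num
  rw [threeWord_map_first i k hk (by linarith) (by linarith), if_neg h, halfPoint]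
  congr 1
  push_cast
  ring

theorem branch_second_inner (i : Fin 3) (k : ℕ) (hk : k ≤ 1 := by decide)
    (h : ¬(i = 2 ∧ k = 0) := by decide) : Branch (i, k) (threeLetter i (k + 1), 0) 2 3 := by
  refine ⟨by norm_num, by norm_num, fun s hs => ?_⟩
  obtain ⟨h0, h1⟩ := hs
  norm_num
  rw [threeWord_map_second i k hk (by linarith) (by linarith), if_neg (by simpa using h), halfPoint]
  congr 1
  push_cast
  ring

theorem branch_second_outer (i : Fin 3) (k : ℕ) (hk : k ≤ 1 := by decide)
    (h : ¬(i = 2 ∧ k = 0) := by decide) : Branch (i, k) (threeLetter i (k + 1), 1) 3 4 := by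
  refine ⟨by norm_num, by norm_num, fun s hs => ?_⟩
  obtain ⟨h0, h1⟩ := hs
  norm_num
  rw [threeWord_map_second i k hk (by linarith) (by linarith), if_neg (by simpa using h), halfPoint]
  congr 1
  push_cast
  ring

theorem branch_half_first : Branch (2, 1) (1, 0) 2 0 := by
  refine ⟨by norm_num, by norm_num, fun s hs => ?_⟩
  obtain ⟨h0, h1⟩ := hs
  norm_num
  rw [threeWord_map_first 2 1 le_rfl (by linarith) (by linarith), if_pos ⟨rfl, rfl⟩, halfPoint]
  congr 1
  push_cast
  ring

theorem branch_half_second : Branch (2, 0) (1, 0) 2 4 := by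
  refine ⟨by norm_num, by norm_num, fun s hs => ?_⟩
  obtain ⟨h0, h1⟩ := hs
  norm_num
  rw [threeWord_map_second 2 0 zero_le_one (by linarith) (by linarith), if_pos ⟨rfl, rfl⟩,
    halfPoint]
  congr 1
  push_cast
  ring

theorem move_zero {c d : Fin 3 × ℕ} {x y x' y' : Bool}
    (h : ∀ s ∈ Icc (0 : ℝ) 1, 1 / 4 ≤ dist
      (halfPoint c ((1 - s) * cond x 1 0 + s * cond x' 1 0))
      (halfPoint d ((1 - s) * cond y 1 0 + s * cond y' 1 0))) : Move 0 c d x y x' y' := by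
  have aux : ∀ (x x' : Bool), ∀ s ∈ Icc (0 : ℝ) 1,
      (1 - s) * cond x 1 0 + s * cond x' 1 0 ∈ Icc (0 : ℝ) 1 := by
    rintro x x' s ⟨h0, h1⟩
    cases x <;> cases x' <;> constructor <;> simp <;> linarith
  refine JoinedIn.ofLine (f := fun s => ((1 - s) * cond x 1 0 + s * cond x' 1 0,
    (1 - s) * cond y 1 0 + s * cond y' 1 0)) (by fun_prop) ?_ ?_ ?_
  · cases x <;> cases y <;> simp
  · cases x' <;> cases y' <;> simp
  · rintro _ ⟨s, hs, rfl⟩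
    exact ⟨aux _ _ s hs, aux _ _ s hs, h s hs⟩

/-- The moves whose lifts are concatenations of moves. Their names list the starting pair and the
final pair; `o` is the branch point, and `mi` and `ei` are the middle and the end of the leg `i`. -/
structure Moves (k : ℕ) : Prop where
  m0m2_e0e2 : Move k (0, 1) (2, 1) false false true true
  om2_m0m2 : Move k (0, 0) (2, 1) false false true false
  m0o_m0m2 : Move k (0, 0) (2, 0) true false true true
  om1_m0o : Move k (0, 0) (1, 0) false true true false
  e0m1_e0e1 : Move k (0, 1) (1, 1) true false true true
  om0_m1e0 : Move k (1, 0) (0, 1) false false true true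
  om2_m1o : Move k (1, 0) (2, 0) false true true false
  om1_m1e1 : Move k (1, 0) (1, 1) false false true true
  e1m2_e1e2 : Move k (1, 1) (2, 1) true false true true
  om1_m2e1 : Move k (2, 0) (1, 1) false false true true

theorem le_dist_halfPoint {c d : Fin 3 × ℕ} {s t : ℝ} (i : Fin 3)
    (h : 1 / 4 ≤ |halfPoint c s i - halfPoint d t i|) :
    1 / 4 ≤ dist (halfPoint c s) (halfPoint d t) :=
  h.trans (dist_le_pi_dist (halfPoint c s) (halfPoint d t) i)

theorem moves_zero : Moves 0 where
  m0m2_e0e2 := move_zero fun s ⟨h0, h1⟩ => le_dist_halfPoint 0 <| le_abs'.2 <| by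
    simp [halfPoint]
    right
    linarith
  om2_m0m2 := move_zero fun s ⟨h0, h1⟩ => le_dist_halfPoint 2 <| le_abs'.2 <| by
    simp [halfPoint]
    left
    linarith
  m0o_m0m2 := move_zero fun s ⟨h0, h1⟩ => le_dist_halfPoint 0 <| le_abs'.2 <| by
    simp [halfPoint]
    right
    linarith
  om1_m0o := move_zero fun s ⟨h0, h1⟩ => by
    rcases le_total s (1 / 2) with h | h
    · refine le_dist_halfPoint 1 (le_abs'.2 ?_)
      simp [halfPoint]
      left
      linarith
    · refine le_dist_halfPoint 0 (le_abs'.2 ?_)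
      simp [halfPoint]
      right
      linarith
  e0m1_e0e1 := move_zero fun s ⟨h0, h1⟩ => le_dist_halfPoint 0 <| le_abs'.2 <| by
    simp [halfPoint]
    right
    linarith
  om0_m1e0 := move_zero fun s ⟨h0, h1⟩ => le_dist_halfPoint 0 <| le_abs'.2 <| by
    simp [halfPoint]
    left
    linarith
  om2_m1o := move_zero fun s ⟨h0, h1⟩ => by
    rcases le_total s (1 / 2) with h | h
    · refine le_dist_halfPoint 2 (le_abs'.2 ?_)
      simp [halfPoint]
      left
      linarith
    · refine le_dist_halfPoint 1 (le_abs'.2 ?_)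
      simp [halfPoint]
      right
      linarith
  om1_m1e1 := move_zero fun s ⟨h0, h1⟩ => le_dist_halfPoint 1 <| le_abs'.2 <| by
    simp [halfPoint]
    left
    linarith
  e1m2_e1e2 := move_zero fun s ⟨h0, h1⟩ => le_dist_halfPoint 1 <| le_abs'.2 <| by
    simp [halfPoint]
    right
    linarith
  om1_m2e1 := move_zero fun s ⟨h0, h1⟩ => le_dist_halfPoint 1 <| le_abs'.2 <| by
    simp [halfPoint]
    left
    linarith

theorem Moves.succ {k : ℕ} (H : Moves k) : Moves (k + 1) where
  m0m2_e0e2 := by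
    refine Link.trans (H.om1_m1e1.symm.swap.lift (branch_first_outer 0 1) branch_half_first :) ?_
    refine Link.trans (H.om2_m1o.symm.lift (branch_first_inner 0 1) (branch_second_inner 2 1) :) ?_
    refine Link.trans (H.om2_m0m2.lift (branch_second_inner 0 1) (branch_second_outer 2 1) :) ?_
    exact (H.m0m2_e0e2.lift (branch_second_outer 0 1) (branch_second_outer 2 1) :)
  om2_m0m2 := by
    refine Link.trans (H.om0_m1e0.symm.swap.lift (branch_first_outer 0 0) branch_half_first :) ?_
    refine Link.trans (H.m0o_m0m2.lift (branch_first_inner 0 0) (branch_second_inner 2 1) :) ?_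
    refine Link.trans (H.om2_m0m2.symm.lift (branch_first_inner 0 0) (branch_second_outer 2 1) :) ?_
    refine Link.trans (H.om2_m1o.lift (branch_second_inner 0 0) (branch_second_inner 2 1) :) ?_
    exact (H.om1_m1e1.swap.lift (branch_second_outer 0 0) branch_half_first :)
  m0o_m0m2 := by
    refine Link.trans (H.e0m1_e0e1.symm.swap.lift (branch_second_outer 0 0)
      (branch_first_outer 2 0) :) ?_
    refine Link.trans (H.om0_m1e0.symm.lift (branch_second_inner 0 0) (branch_first_outer 2 0) :) ?_
    refine Link.trans (H.om1_m0o.symm.swap.lift (branch_second_inner 0 0)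
      (branch_first_inner 2 0) :) ?_
    exact (H.om1_m1e1.swap.lift (branch_second_outer 0 0) branch_half_second :)
  om1_m0o := by
    refine Link.trans (H.m0m2_e0e2.symm.lift (branch_first_outer 0 0)
      (branch_second_outer 1 0) :) ?_
    refine Link.trans (H.om2_m0m2.symm.lift (branch_first_inner 0 0) (branch_second_outer 1 0) :) ?_
    refine Link.trans (H.om2_m1o.lift (branch_second_inner 0 0) (branch_second_inner 1 0) :) ?_
    refine Link.trans (H.om1_m0o.swap.lift (branch_second_inner 0 0) (branch_first_inner 1 0) :) ?_
    refine Link.trans (H.om0_m1e0.lift (branch_second_inner 0 0) (branch_first_outer 1 0) :) ?_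
    exact (H.e0m1_e0e1.swap.lift (branch_second_outer 0 0) (branch_first_outer 1 0) :)
  e0m1_e0e1 := by
    refine Link.trans (H.m0m2_e0e2.symm.lift (branch_second_outer 0 1)
      (branch_first_outer 1 1) :) ?_
    refine Link.trans (H.m0o_m0m2.symm.lift (branch_second_inner 0 1) (branch_first_inner 1 1) :) ?_
    refine Link.trans (H.om0_m1e0.swap.lift (branch_second_outer 0 1)
      (branch_second_inner 1 1) :) ?_
    exact (H.e0m1_e0e1.lift (branch_second_outer 0 1) (branch_second_outer 1 1) :)
  om0_m1e0 := by
    refine Link.trans (H.e0m1_e0e1.symm.lift (branch_first_outer 1 0) (branch_first_outer 0 1) :) ?_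
    refine Link.trans (H.om0_m1e0.symm.swap.lift (branch_first_outer 1 0)
      (branch_first_inner 0 1) :) ?_
    refine Link.trans (H.om1_m0o.symm.lift (branch_first_inner 1 0) (branch_first_inner 0 1) :) ?_
    refine Link.trans (H.om2_m1o.symm.swap.lift (branch_second_inner 1 0)
      (branch_first_inner 0 1) :) ?_
    refine Link.trans (H.om2_m0m2.swap.lift (branch_second_outer 1 0)
      (branch_second_inner 0 1) :) ?_
    exact (H.m0m2_e0e2.swap.lift (branch_second_outer 1 0) (branch_second_outer 0 1) :)
  om2_m1o := by
    refine Link.trans (H.om0_m1e0.symm.swap.lift (branch_first_outer 1 0) branch_half_second :) ?_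
    refine Link.trans (H.om1_m0o.symm.lift (branch_first_inner 1 0) branch_half_second :) ?_
    refine Link.trans (H.om2_m1o.symm.swap.lift (branch_second_inner 1 0) branch_half_second :) ?_
    refine Link.trans (H.om2_m0m2.swap.lift (branch_second_outer 1 0) (branch_first_inner 2 0) :) ?_
    exact (H.m0m2_e0e2.swap.lift (branch_second_outer 1 0) (branch_first_outer 2 0) :)
  om1_m1e1 := by
    refine Link.trans (H.m0m2_e0e2.symm.lift (branch_first_outer 1 0) (branch_first_outer 1 1) :) ?_
    refine Link.trans (H.m0o_m0m2.symm.lift (branch_first_inner 1 0) (branch_first_inner 1 1) :) ?_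
    refine Link.trans (H.om1_m0o.symm.lift (branch_first_inner 1 0) (branch_second_inner 1 1) :) ?_
    refine Link.trans (H.om1_m2e1.lift (branch_second_inner 1 0) (branch_second_outer 1 1) :) ?_
    exact (H.e1m2_e1e2.swap.lift (branch_second_outer 1 0) (branch_second_outer 1 1) :)
  e1m2_e1e2 := by
    refine Link.trans (H.om1_m1e1.symm.swap.lift (branch_second_outer 1 1) branch_half_first :) ?_
    refine Link.trans (H.om1_m2e1.swap.lift (branch_second_outer 1 1)
      (branch_second_inner 2 1) :) ?_
    exact (H.e1m2_e1e2.lift (branch_second_outer 1 1) (branch_second_outer 2 1) :)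
  om1_m2e1 := by
    refine Link.trans (H.m0m2_e0e2.symm.lift (branch_first_outer 2 0) (branch_first_outer 1 1) :) ?_
    refine Link.trans (H.m0o_m0m2.symm.lift (branch_first_inner 2 0) (branch_first_inner 1 1) :) ?_
    refine Link.trans (H.om1_m0o.symm.lift (branch_first_inner 2 0) (branch_second_inner 1 1) :) ?_
    exact (H.om1_m1e1.lift branch_half_second (branch_second_outer 1 1) :)

theorem moves (k : ℕ) : Moves k := by
  induction k with
  | zero => exact moves_zero
  | succ k ih => exact ih.succ

theorem Move.joinedIn {k : ℕ} {c d : Fin 3 × ℕ} {x y x' y' : Bool} (h : Move k c d x y x' y')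
    (hc : c.2 ≤ 1) (hd : d.2 ≤ 1) :
    JoinedIn {p : (Fin 3 → ℝ) × (Fin 3 → ℝ) | p.1 ∈ star 3 ∧ p.2 ∈ star 3 ∧
        1 / 4 ≤ dist (threeWord.map^[k] p.1) (threeWord.map^[k] p.2)}
      (halfPoint c (cond x 1 0), halfPoint d (cond y 1 0))
      (halfPoint c (cond x' 1 0), halfPoint d (cond y' 1 0)) := by
  have hf : Continuous fun p : ℝ × ℝ => (halfPoint c p.1, halfPoint d p.2) :=
    ((continuous_halfPoint c).comp continuous_fst).prodMk
      ((continuous_halfPoint d).comp continuous_snd)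
  have aux : ∀ {c : Fin 3 × ℕ} {s : ℝ}, c.2 ≤ 1 → s ∈ Icc (0 : ℝ) 1 →
      halfPoint c s ∈ star 3 := by
    rintro c s hc ⟨h0, h1⟩
    have hc' : (c.2 : ℝ) ≤ 1 := by exact_mod_cast hc
    have h0' : (0 : ℝ) ≤ c.2 := c.2.cast_nonneg
    exact single_mem_star _ ⟨by linarith, by linarith⟩
  have key := JoinedIn.map h hf
  replace key := key.mono (V := {p : (Fin 3 → ℝ) × (Fin 3 → ℝ) | p.1 ∈ star 3 ∧ p.2 ∈ star 3 ∧
        1 / 4 ≤ dist (threeWord.map^[k] p.1) (threeWord.map^[k] p.2)}) <| by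
    rintro _ ⟨p, ⟨h1, h2, h3⟩, rfl⟩
    exact ⟨aux hc h1, aux hd h2, h3⟩
  cases x <;> cases y <;> cases x' <;> cases y' <;> simpa using key

/-- Every iterate of the word map with three legs separates the pairs on some path from a pair of
points to the reversed pair. -/
theorem exists_joinedIn_swap (k : ℕ) : ∃ z w : Fin 3 → ℝ,
    JoinedIn {p : (Fin 3 → ℝ) × (Fin 3 → ℝ) | p.1 ∈ star 3 ∧ p.2 ∈ star 3 ∧
        1 / 4 ≤ dist (threeWord.map^[k] p.1) (threeWord.map^[k] p.2)} (z, w) (w, z) := by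
  have h1 := (moves k).om1_m0o.joinedIn zero_le_one zero_le_one
  have h2 := (moves k).m0o_m0m2.joinedIn zero_le_one zero_le_one
  have h3 := (moves k).om2_m0m2.symm.joinedIn zero_le_one le_rfl
  have h4 := (moves k).om2_m1o.joinedIn zero_le_one zero_le_one
  refine ⟨0, Pi.single 1 (1 / 2), ?_⟩
  simp [halfPoint] at h1 h2 h3 h4
  simpa using h1.trans (h2.trans (h3.trans h4))

theorem pos_of_joinedIn {X : Type*} [PseudoMetricSpace X] {G : Set X} {D : X → ℝ} {η ζ : ℝ}
    (hζ : 0 < ζ) (hG : ∀ p ∈ G, η ≤ |D p|)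
    (hD : ∀ p ∈ G, ∀ q ∈ G, dist p q < ζ → |D p - D q| < 2 * η) {p q : X}
    (h : JoinedIn G p q) (hp : 0 < D p) : 0 < D q := by
  have step : ∀ p ∈ G, ∀ q ∈ G, dist p q < ζ → 0 < D p → 0 < D q := by
    intro p hp q hq hpq h0
    by_contra! h1
    have h2 := hG p hp
    have h3 := hG q hq
    have h4 := (abs_lt.1 (hD p hp q hq hpq)).2
    rw [abs_of_pos h0] at h2
    rw [abs_of_nonpos h1] at h3
    linarith
  have hl : IsLocallyConstant fun t => 0 < D (h.somePath t) := by
    refine (IsLocallyConstant.iff_eventually_eq _).2 fun t => ?_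
    filter_upwards [h.somePath.continuous.continuousAt (Metric.ball_mem_nhds _ hζ)] with s hs
    have hs' : dist (h.somePath s) (h.somePath t) < ζ := hs
    exact propext ⟨step _ (h.somePath_mem s) _ (h.somePath_mem t) hs',
      step _ (h.somePath_mem t) _ (h.somePath_mem s) (by rwa [dist_comm])⟩
  have key := hl.apply_eq_of_preconnectedSpace 0 1
  simp only [Path.source, Path.target] at key
  exact key ▸ hp

theorem dist_le_of_mem_star_two {u v : Fin 2 → ℝ} (hu : u ∈ star 2) (hv : v ∈ star 2) :
    dist u v ≤ |(u 0 - u 1) - (v 0 - v 1)| := by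
  obtain ⟨i, a, ⟨ha, -⟩, rfl⟩ := hu
  obtain ⟨j, b, ⟨hb, -⟩, rfl⟩ := hv
  refine (dist_pi_le_iff (abs_nonneg _)).2 fun l => ?_
  rw [Real.dist_eq]
  fin_cases i <;> fin_cases j <;> fin_cases l <;> simp [abs_of_nonneg, *] <;> grind

theorem not_isLike_threeWord :
    letI := threeWord.limitMetric
    ¬ IsLike threeWord.limit (simpleOdSet 2) := by
  intro hlike
  obtain ⟨N, η, ζ, h, hη, hζ, hh, hc, hs⟩ :=
    isExpanding_threeWord.exists_approx hlike (ε := 1 / 4) (by norm_num)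
  obtain ⟨z, w, hj⟩ := exists_joinedIn_swap N
  set D : (Fin 3 → ℝ) × (Fin 3 → ℝ) → ℝ :=
    fun p => (h p.1 0 - h p.1 1) - (h p.2 0 - h p.2 1) with hD
  have hG : ∀ p ∈ {p : (Fin 3 → ℝ) × (Fin 3 → ℝ) | p.1 ∈ star 3 ∧ p.2 ∈ star 3 ∧
      1 / 4 ≤ dist (threeWord.map^[N] p.1) (threeWord.map^[N] p.2)}, η ≤ |D p| := by
    rintro p ⟨h1, h2, h3⟩
    refine le_trans ?_ (dist_le_of_mem_star_two (hh _ h1) (hh _ h2))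
    by_contra! h4
    exact h3.not_gt (hs _ h1 _ h2 h4)
  have hd : ∀ z ∈ star 3, ∀ w ∈ star 3, dist z w < ζ →
      |(h z 0 - h z 1) - (h w 0 - h w 1)| < η := by
    intro z hz w hw hzw
    have h0 := (dist_le_pi_dist (h z) (h w) 0).trans_lt (hc z hz w hw hzw)
    have h1 := (dist_le_pi_dist (h z) (h w) 1).trans_lt (hc z hz w hw hzw)
    rw [Real.dist_eq, abs_lt] at h0 h1
    rw [abs_lt]
    constructor <;> linarith
  have hD' : ∀ p ∈ {p : (Fin 3 → ℝ) × (Fin 3 → ℝ) | p.1 ∈ star 3 ∧ p.2 ∈ star 3 ∧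
      1 / 4 ≤ dist (threeWord.map^[N] p.1) (threeWord.map^[N] p.2)},
      ∀ q ∈ {p : (Fin 3 → ℝ) × (Fin 3 → ℝ) | p.1 ∈ star 3 ∧ p.2 ∈ star 3 ∧
      1 / 4 ≤ dist (threeWord.map^[N] p.1) (threeWord.map^[N] p.2)}, dist p q < ζ →
      |D p - D q| < 2 * η := by
    rintro p ⟨h1, h2, -⟩ q ⟨h1', h2', -⟩ hpq
    rw [Prod.dist_eq, max_lt_iff] at hpq
    have e1 := abs_lt.1 (hd _ h1 _ h1' hpq.1)
    have e2 := abs_lt.1 (hd _ h2 _ h2' hpq.2)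
    rw [abs_lt]
    constructor <;> simp only [hD] <;> linarith
  have hanti : D (w, z) = -D (z, w) := by simp [hD]
  have h0 : η ≤ |D (z, w)| := hG _ hj.source_mem
  rcases lt_or_ge 0 (D (z, w)) with hp | hp
  · have := pos_of_joinedIn hζ hG hD' hj hp
    linarith
  · rw [abs_of_nonpos hp] at h0
    have := pos_of_joinedIn hζ hG hD' hj.symm (by linarith)
    linarith

end SimpleOd

/-- For every integer `n ≥ 3` there is an indecomposable continuum `K`
which is simple-`n`-od-like, is not simple-`(n-1)`-od-like, and each of whose proper
nondegenerate subcontinua is an arc. -/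
theorem statement6 (n : ℕ) (hn : 3 ≤ n) :
    ∃ (K : Type) (_ : MetricSpace K), CompactSpace K ∧ ConnectedSpace K ∧ Nonempty K ∧
      IndecomposableSpace K ∧
      IsLike K (simpleOdSet n) ∧ ¬ IsLike K (simpleOdSet (n - 1)) ∧
      ∀ A : Set K, IsCompact A → IsConnected A → A ≠ Set.univ → A.Nontrivial →
        IsArcSet A := by
  rcases hn.eq_or_lt with rfl | h
  · exact SimpleOd.isExpanding_threeWord.exists_continuum le_rfl SimpleOd.not_isLike_threeWord
  · have : NeZero n := ⟨by omega⟩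
    have hW := SimpleOd.isExpanding_codeWord (n := n) (by omega)
    exact hW.exists_continuum hn
      ((SimpleOd.isCode_codeWord h).not_isLike hW hn (Nat.sub_lt (by omega) one_pos))
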